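/- arXiv:1312.5953 — 11 statements merged into one kernel-verified Lean document; each statement's English description precedes it below -/
import Mathlib

section
/- Let n be a positive integer and K a field whose characteristic does not divide the integer ELS(n) − OLS(n). Then Rota's basis conjecture RBC_n(K) holds: for every n × n array (v_{ij}) of vectors in K^n such that for each i = 1,…,n the i-th row (v_{i1},…,v_{in}) is a basis of K^n, there exist permutations π_1,…,π_n of {1,…,n} such that for every j = 1,…,n the vectors v_{1,π_1(j)}, …, v_{n,π_n(j)} form a basis of K^n. -/
/-- The signed count `ELS(n) − OLS(n)` of Latin squares of order `n`.
A Latin square is encoded as a pair `p = (r, c)` where `r i` is the permutation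
given by the `i`-th row and `c j` is the permutation given by the `j`-th column;
the compatibility condition `c j i = r i j` says that `r` and `c` come from one
and the same square array whose rows and columns are all permutations.
Each such square contributes its sign (the product of the signs of its `n` row
permutations and its `n` column permutations), so the total is `ELS(n) − OLS(n)`. -/
def latinSquareSignedCount (n : ℕ) : ℤ :=
  ∑ p ∈ Finset.univ.filter
      (fun p : (Fin n → Equiv.Perm (Fin n)) × (Fin n → Equiv.Perm (Fin n)) =>
        ∀ i j, p.2 j i = p.1 i j),
    (((∏ i, Equiv.Perm.sign (p.1 i)) * ∏ j, Equiv.Perm.sign (p.2 j) : ℤˣ) : ℤ)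

theorem rota_aux_det (n : ℕ) (K : Type*) [Field K] (A : Matrix (Fin n) (Fin n) K)
    (f : Fin n → Fin n) :
    (A.submatrix id f).det
      = (∑ r : Equiv.Perm (Fin n),
          if ∀ j, f j = r j then ((Equiv.Perm.sign r : ℤ) : K) else 0) * A.det := by
  by_cases hf : Function.Injective f
  · have hb : Function.Bijective f := Finite.injective_iff_bijective.mp hf
    rw [Finset.sum_eq_single (Equiv.ofBijective f hb)]
    · have := Matrix.det_permute' (Equiv.ofBijective f hb) A
      simpa using this
    · intro r _ hr
      rw [if_neg]
      intro h
      apply hr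
      ext j
      simp [h j]
    · simp
  · rw [Finset.sum_eq_zero]
    · rw [zero_mul]
      simp only [Function.Injective, not_forall] at hf
      obtain ⟨a, b, hab, hne⟩ := hf
      exact Matrix.det_zero_of_column_eq hne (by intro k; simp [hab])
    · intro r _
      rw [if_neg]
      intro h
      apply hf
      have : f = r := funext h
      rw [this]
      exact r.injective

theorem rota_aux_onn (n : ℕ) (K : Type*) [Field K] (v : Fin n → Fin n → (Fin n → K)) :
    (∑ π : Fin n → Equiv.Perm (Fin n),
      (∏ i, ((Equiv.Perm.sign (π i) : ℤ) : K)) *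
        ∏ j, (Matrix.of fun a i => v i (π i j) a).det)
    = ((latinSquareSignedCount n : ℤ) : K) * ∏ i, (Matrix.of (v i)).det := by
  have h1 : ∀ π : Fin n → Equiv.Perm (Fin n),
      ∏ j, (Matrix.of fun a i => v i (π i j) a).det =
      ∑ σ : Fin n → Equiv.Perm (Fin n), (∏ j, ((Equiv.Perm.sign (σ j) : ℤ) : K)) *
        ∏ i, ∏ j, v i (π i j) (σ j i) := by
    intro π
    simp only [Matrix.det_apply', Matrix.of_apply]
    rw [Fintype.prod_sum]
    refine Finset.sum_congr rfl fun σ _ => ?_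
    rw [Finset.prod_mul_distrib]
    congr 1
    exact Finset.prod_comm
  have h2 : ∀ σ : Fin n → Equiv.Perm (Fin n),
      ∑ π : Fin n → Equiv.Perm (Fin n), (∏ i, ((Equiv.Perm.sign (π i) : ℤ) : K)) *
        ∏ i, ∏ j, v i (π i j) (σ j i) =
      ∏ i, ((Matrix.of (v i)).submatrix id (fun j => σ j i)).det := by
    intro σ
    simp only [Matrix.det_apply', Matrix.of_apply, Matrix.submatrix_apply, id]
    rw [Fintype.prod_sum]
    refine Finset.sum_congr rfl fun π _ => ?_
    rw [Finset.prod_mul_distrib]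
  simp only [h1, Finset.mul_sum]
  rw [Finset.sum_comm]
  have h3 : ∀ σ : Fin n → Equiv.Perm (Fin n),
      ∑ π : Fin n → Equiv.Perm (Fin n), (∏ i, ((Equiv.Perm.sign (π i) : ℤ) : K)) *
        ((∏ j, ((Equiv.Perm.sign (σ j) : ℤ) : K)) * ∏ i, ∏ j, v i (π i j) (σ j i)) =
      (∑ r : Fin n → Equiv.Perm (Fin n), if ∀ i j, σ j i = r i j then
        (∏ i, ((Equiv.Perm.sign (r i) : ℤ) : K)) * (∏ j, ((Equiv.Perm.sign (σ j) : ℤ) : K))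
        else 0) * ∏ i, (Matrix.of (v i)).det := by
    intro σ
    simp only [mul_left_comm _ (∏ j, ((Equiv.Perm.sign (σ j) : ℤ) : K)) _]
    rw [← Finset.mul_sum, h2]
    simp only [rota_aux_det]
    rw [Finset.prod_mul_distrib, ← mul_assoc, Fintype.prod_sum, Finset.mul_sum]
    congr 1
    refine Finset.sum_congr rfl fun r _ => ?_
    rw [Finset.prod_ite_zero]
    simp only [Finset.mem_univ, true_imp_iff]
    split_ifs
    · ring
    · ring
  simp only [h3]
  rw [← Finset.sum_mul]
  congr 1
  rw [Finset.sum_comm, latinSquareSignedCount, Finset.sum_filter, Fintype.sum_prod_type]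
  push_cast
  rfl

/-- Rota's basis conjecture `RBC_n(K)` holds whenever the characteristic of `K`
does not divide `ELS(n) − OLS(n)`. -/
theorem rota_basis_conjecture_of_latin_signed_count_ne_zero
    (n : ℕ) (hn : 0 < n) (K : Type*) [Field K]
    (hchar : ((latinSquareSignedCount n : ℤ) : K) ≠ 0)
    (v : Fin n → Fin n → (Fin n → K))
    (hrows : ∀ i, LinearIndependent K (v i) ∧
      Submodule.span K (Set.range (v i)) = ⊤) :
    ∃ π : Fin n → Equiv.Perm (Fin n),
      ∀ j, LinearIndependent K (fun i => v i (π i j)) ∧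
        Submodule.span K (Set.range fun i => v i (π i j)) = ⊤ := by
  have hdet : ∀ i, (Matrix.of (v i)).det ≠ 0 := by
    intro i
    have h : LinearIndependent K (Matrix.of (v i)).row := (hrows i).1
    rw [Matrix.linearIndependent_rows_iff_isUnit, Matrix.isUnit_iff_isUnit_det] at h
    exact h.ne_zero
  have hne := mul_ne_zero hchar (Finset.prod_ne_zero_iff.mpr fun i (_ : i ∈ Finset.univ) => hdet i)
  rw [← rota_aux_onn] at hne
  obtain ⟨π, -, hπ⟩ := Finset.exists_ne_zero_of_sum_ne_zero hne
  refine ⟨π, fun j => ?_⟩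
  have hj := Finset.prod_ne_zero_iff.mp (right_ne_zero_of_mul hπ) j (Finset.mem_univ j)
  have hli : LinearIndependent K (fun i => v i (π i j)) := by
    have h := (Matrix.isUnit_iff_isUnit_det _).mpr (isUnit_iff_ne_zero.mpr hj)
    exact Matrix.linearIndependent_cols_iff_isUnit.mpr h
  exact ⟨hli, hli.span_eq_top_of_card_eq_finrank' (by simp)⟩
end

section
/- Let n be a positive integer and K a field whose characteristic does not divide the integer ELS(n) − OLS(n). Then the online version OBC_n(K) of Rota's basis conjecture holds: there exist functions s_1,…,s_n, where s_i takes as input an i × n array of vectors of K^n (the first i rows) and outputs a permutation of {1,…,n}, such that for every n × n array (v_{ij}) of vectors in K^n all of whose rows are bases of K^n, setting π_i := s_i(v_{1•},…,v_{i•}) for i = 1,…,n (so π_i depends only on the first i rows), every column j of the rearranged array, namely the vectors v_{1,π_1(j)}, …, v_{n,π_n(j)}, is a basis of K^n. -/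
namespace OnlineRota
open Finset Function

variable {K : Type*} [Field K] {n : ℕ}

noncomputable def sg (K : Type*) [Field K] {n : ℕ} (p : Equiv.Perm (Fin n)) : K :=
  ((Equiv.Perm.sign p : ℤ) : K)

noncomputable def P (w : Fin n → Fin n → (Fin n → K)) : K :=
  ∏ j, Matrix.det (Matrix.of fun i => w i j)

def T (S : Finset (Fin n)) (i : Fin n) : Finset (Equiv.Perm (Fin n)) :=
  if i ∈ S then univ else {1}

noncomputable def e (K : Type*) [Field K] {n : ℕ} (a : Fin n) : Fin n → K :=
  Pi.basisFun K (Fin n) a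

noncomputable def mix (S : Finset (Fin n)) (w : Fin n → Fin n → (Fin n → K))
    (σ : Fin n → Equiv.Perm (Fin n)) : Fin n → Fin n → (Fin n → K) :=
  fun i => if i ∈ S then (fun j => e K (σ i j)) else w i

noncomputable def C (S : Finset (Fin n)) (w : Fin n → Fin n → (Fin n → K)) : K :=
  ∑ σ ∈ Fintype.piFinset (T S), (∏ i, sg K (σ i)) * P (mix S w σ)

theorem P_multi (w : Fin n → Fin n → (Fin n → K)) (k : Fin n) :
    ∃ M : MultilinearMap K (fun _ : Fin n => Fin n → K) K,
      ∀ u, P (update w k u) = M u := by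
  refine ⟨(MultilinearMap.mkPiAlgebra K (Fin n) K).compLinearMap
    (fun j => (Matrix.detRowAlternating (R := K) (n := Fin n)).toMultilinearMap.toLinearMap
      (fun i => w i j) k), fun u => ?_⟩
  simp only [P, MultilinearMap.compLinearMap_apply, MultilinearMap.mkPiAlgebra_apply,
    MultilinearMap.toLinearMap_apply]
  refine Finset.prod_congr rfl fun j _ => ?_
  change _ = Matrix.det _
  congr 1
  ext i l
  by_cases h : i = k
  · subst h; simp
  · simp [h]

theorem mix_update (S : Finset (Fin n)) (w : Fin n → Fin n → (Fin n → K))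
    (σ : Fin n → Equiv.Perm (Fin n)) (k : Fin n) (hk : k ∉ S) (u : Fin n → Fin n → K) :
    mix S (update w k u) σ = update (mix S w σ) k u := by
  funext i
  by_cases h : i = k
  · subst h; simp [mix, hk]
  · simp [mix, h]

theorem C_multi (S : Finset (Fin n)) (w : Fin n → Fin n → (Fin n → K)) (k : Fin n)
    (hk : k ∉ S) :
    ∃ M : MultilinearMap K (fun _ : Fin n => Fin n → K) K,
      ∀ u, C S (update w k u) = M u := by
  choose M hM using fun σ => P_multi (mix S w σ) k
  refine ⟨∑ σ ∈ Fintype.piFinset (T S), (∏ i, sg K (σ i)) • M σ, fun u => ?_⟩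
  simp only [C, MultilinearMap.sum_apply, MultilinearMap.smul_apply, smul_eq_mul, ← hM]
  refine Finset.sum_congr rfl fun σ _ => ?_
  rw [mix_update S w σ k hk]

theorem C_insert (S : Finset (Fin n)) (w : Fin n → Fin n → (Fin n → K)) (k : Fin n)
    (hk : k ∉ S) :
    C (insert k S) w = ∑ p, sg K p * C S (update w k (fun j => e K (p j))) := by
  simp only [C, Finset.mul_sum]
  rw [← Finset.sum_product']
  symm
  refine Finset.sum_bij' (fun a _ => update a.2 k a.1) (fun σ _ => (σ k, update σ k 1))
    ?_ ?_ ?_ ?_ ?_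
  · rintro ⟨p, σ⟩ h
    simp only [mem_product, mem_univ, true_and, Fintype.mem_piFinset] at h ⊢
    intro i
    by_cases hi : i = k
    · subst hi; simp [T]
    · have := h i
      simpa [T, hi] using this
  · intro σ h
    simp only [mem_product, mem_univ, true_and, Fintype.mem_piFinset] at h ⊢
    intro i
    by_cases hi : i = k
    · subst hi; simp [T, hk]
    · have := h i
      simpa [T, hi] using this
  · rintro ⟨p, σ⟩ h
    simp only [mem_product, mem_univ, true_and, Fintype.mem_piFinset] at h
    have := h k
    simp only [T, hk, if_false, mem_singleton] at this
    simp [← this]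
  · intro σ h
    simp
  · rintro ⟨p, σ⟩ h
    simp only [mem_product, mem_univ, true_and, Fintype.mem_piFinset] at h
    have h1 := h k
    simp only [T, hk, if_false, mem_singleton] at h1
    rw [← mul_assoc]
    congr 1
    · rw [← Finset.mul_prod_erase univ _ (mem_univ k),
        ← Finset.mul_prod_erase univ (fun i => sg K (update σ k p i)) (mem_univ k)]
      simp only [h1, update_self]
      have : sg K (1 : Equiv.Perm (Fin n)) = 1 := by simp [sg]
      rw [this, one_mul]
      congr 1
      refine Finset.prod_congr rfl fun i hi => ?_
      rw [update_of_ne (Finset.ne_of_mem_erase hi)]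
    · congr 1
      funext i
      by_cases hi : i = k
      · subst hi; simp [mix, hk]
      · simp [mix, hi]

theorem step (S : Finset (Fin n)) (w : Fin n → Fin n → (Fin n → K)) (k : Fin n)
    (hk : k ∉ S) (hw : C (insert k S) w ≠ 0) (u : Fin n → Fin n → K)
    (hu : LinearIndependent K u) (hs : Submodule.span K (Set.range u) = ⊤) :
    ∃ p : Equiv.Perm (Fin n), C S (update w k (fun j => u (p j))) ≠ 0 := by
  obtain ⟨M, hM⟩ := C_multi S w k hk
  by_contra! hcon
  have h1 : MultilinearMap.alternatization M u = 0 := by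
    rw [MultilinearMap.alternatization_apply]
    refine Finset.sum_eq_zero fun p _ => ?_
    rw [MultilinearMap.domDomCongr_apply, ← hM, hcon p, smul_zero]
  have h2 : MultilinearMap.alternatization M (e K) = C (insert k S) w := by
    rw [MultilinearMap.alternatization_apply, C_insert S w k hk]
    refine Finset.sum_congr rfl fun p _ => ?_
    rw [MultilinearMap.domDomCongr_apply, ← hM, sg, Units.smul_def, zsmul_eq_mul]
  have h3 := AlternatingMap.eq_smul_basis_det (Module.Basis.mk hu hs.ge)
    (MultilinearMap.alternatization M)
  rw [Module.Basis.coe_mk, h1, zero_smul] at h3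
  rw [← h2, h3] at hw
  exact hw rfl

theorem det_e (f : Fin n → Fin n) :
    Matrix.det (Matrix.of fun i => e K (f i)) =
      ∑ c : Equiv.Perm (Fin n), if (∀ i, c i = f i) then sg K c else 0 := by
  rw [← Matrix.det_transpose, Matrix.det_apply]
  refine Finset.sum_congr rfl fun c _ => ?_
  rw [Units.smul_def, zsmul_eq_mul]
  simp only [Matrix.transpose_apply, Matrix.of_apply, e, Pi.basisFun_apply, Pi.single_apply,
    Finset.prod_ite_zero, Finset.prod_const_one, mem_univ, true_imp_iff, sg, mul_ite, mul_one,
    mul_zero]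

theorem C_univ (w : Fin n → Fin n → (Fin n → K)) :
    C univ w = ((latinSquareSignedCount n : ℤ) : K) := by
  have hT : Fintype.piFinset (T (univ : Finset (Fin n))) = univ := by
    ext σ; simp [T]
  rw [C, hT, latinSquareSignedCount, Finset.sum_filter, ← Finset.univ_product_univ,
    Finset.sum_product, Int.cast_sum]
  refine Finset.sum_congr rfl fun r _ => ?_
  simp only [P, mix, mem_univ, if_true, det_e]
  rw [Fintype.prod_sum, Finset.mul_sum, Int.cast_sum]
  refine Finset.sum_congr rfl fun c _ => ?_
  rw [Finset.prod_ite_zero]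
  have : (∀ j ∈ (univ : Finset (Fin n)), ∀ i, c j i = r i j) ↔ ∀ i j, c j i = r i j :=
    ⟨fun h i j => h j (mem_univ _) i, fun h j _ i => h i j⟩
  simp only [this]
  split_ifs <;> simp [sg]

def up (n m : ℕ) : Finset (Fin n) := univ.filter fun i => m ≤ (i : ℕ)

open Classical in
noncomputable def pick (k : Fin n) (w : Fin n → Fin n → (Fin n → K)) (u : Fin n → Fin n → K) :
    Equiv.Perm (Fin n) :=
  if h : ∃ p : Equiv.Perm (Fin n), C (up n (k + 1)) (update w k (fun j => u (p j))) ≠ 0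
  then h.choose else 1

noncomputable def W (v : Fin n → Fin n → (Fin n → K)) : ℕ → Fin n → Fin n → (Fin n → K)
  | 0 => 0
  | m + 1 => if h : m < n then
      update (W v m) ⟨m, h⟩ (fun j => v ⟨m, h⟩ (pick ⟨m, h⟩ (W v m) (v ⟨m, h⟩) j))
    else W v m

theorem W_congr (v v' : Fin n → Fin n → (Fin n → K)) (m : ℕ)
    (h : ∀ i : Fin n, (i : ℕ) < m → v i = v' i) : W v m = W v' m := by
  induction m with
  | zero => rfl
  | succ m ih =>
    have := ih fun i hi => h i (by omega)
    simp only [W, this]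
    split_ifs with hm
    · rw [h ⟨m, hm⟩ (by simp)]
    · rfl

theorem W_row (v : Fin n → Fin n → (Fin n → K)) (i : Fin n) (m : ℕ) (h : (i : ℕ) < m) :
    W v m i = fun j => v i (pick i (W v i) (v i) j) := by
  induction m with
  | zero => omega
  | succ m ih =>
    rw [W]
    split_ifs with hm
    · by_cases him : i = ⟨m, hm⟩
      · subst him; simp
      · rw [update_of_ne him]
        refine ih ?_
        have : (i : ℕ) ≠ m := fun h' => him (Fin.ext h')
        omega
    · exact ih (by omega)

theorem W_inv (hchar : ((latinSquareSignedCount n : ℤ) : K) ≠ 0)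
    (v : Fin n → Fin n → (Fin n → K))
    (hv : ∀ i, LinearIndependent K (v i) ∧ Submodule.span K (Set.range (v i)) = ⊤) (m : ℕ)
    (hm : m ≤ n) : C (up n m) (W v m) ≠ 0 := by
  induction m with
  | zero =>
    have : up n 0 = univ := by ext; simp [up]
    rw [this, C_univ]; exact hchar
  | succ m ih =>
    have hm' : m < n := hm
    have h0 := ih hm'.le
    have hS : up n m = insert ⟨m, hm'⟩ (up n (m + 1)) := by
      ext i; simp only [up, mem_filter, mem_univ, true_and, mem_insert, Fin.ext_iff]; omega
    rw [hS] at h0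
    have h1 := step _ _ _ (by simp [up]) h0 (v ⟨m, hm'⟩) (hv _).1 (hv _).2
    rw [W, dif_pos hm', pick, dif_pos h1]
    exact h1.choose_spec

theorem C_empty (w : Fin n → Fin n → (Fin n → K)) (h : C (up n n) w ≠ 0) : P w ≠ 0 := by
  intro hP
  apply h
  have : ∀ σ, mix (up n n) w σ = w := by
    intro σ; funext i
    simp [mix, up, i.isLt]
  simp [C, this, hP]

end OnlineRota

/-- The online version `OBC_n(K)` of Rota's basis conjecture holds whenever the
characteristic of `K` does not divide `ELS(n) − OLS(n)`: there is a family of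
strategies `s i`, where `s i` sees only the first `i` rows (here rows
`0, …, i` in `Fin`-indexing, i.e. `i + 1` rows) and outputs the permutation to
be applied to row `i`, such that for every array whose rows are bases all
columns of the rearranged array are bases. -/
theorem online_rota_basis_conjecture_of_latin_signed_count_ne_zero
    (n : ℕ) (hn : 0 < n) (K : Type*) [Field K]
    (hchar : ((latinSquareSignedCount n : ℤ) : K) ≠ 0) :
    ∃ s : (i : Fin n) → (Fin ((i : ℕ) + 1) → Fin n → (Fin n → K)) → Equiv.Perm (Fin n),
      ∀ v : Fin n → Fin n → (Fin n → K),
        (∀ i, LinearIndependent K (v i) ∧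
          Submodule.span K (Set.range (v i)) = ⊤) →
        ∀ j, LinearIndependent K
            (fun i => v i (s i (fun k => v (Fin.castLE i.isLt k)) j)) ∧
          Submodule.span K
            (Set.range fun i => v i (s i (fun k => v (Fin.castLE i.isLt k)) j)) = ⊤ := by
  classical
  refine ⟨fun i rows => OnlineRota.pick i
    (OnlineRota.W (fun k => if h : (k : ℕ) < i + 1 then rows ⟨k, h⟩ else 0) i)
    (rows (Fin.last i)), fun v hv j => ?_⟩
  have hli : LinearIndependent K (fun i => OnlineRota.W v n i j) := by
    have h := OnlineRota.C_empty _ (OnlineRota.W_inv hchar v hv n le_rfl)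
    rw [OnlineRota.P, Finset.prod_ne_zero_iff] at h
    have := Matrix.linearIndependent_rows_of_det_ne_zero (h j (Finset.mem_univ j))
    exact this
  have heq : (fun i : Fin n => OnlineRota.W v n i j) = fun i : Fin n => v i
      (OnlineRota.pick i (OnlineRota.W (fun k => if h : (k : ℕ) < i + 1 then
        (fun k : Fin ((i : ℕ) + 1) => v (Fin.castLE i.isLt k)) ⟨k, h⟩ else 0) i)
        (v (Fin.castLE i.isLt (Fin.last i))) j) := by
    funext i
    rw [OnlineRota.W_row v i n i.isLt]
    have h1 : OnlineRota.W (fun k => if h : (k : ℕ) < i + 1 then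
        (fun k : Fin ((i : ℕ) + 1) => v (Fin.castLE i.isLt k)) ⟨k, h⟩ else 0) i
        = OnlineRota.W v i := by
      refine OnlineRota.W_congr _ _ _ fun k hk => ?_
      rw [dif_pos (by omega)]
      rfl
    rw [h1]
    rfl
  rw [heq] at hli
  exact ⟨hli, hli.span_eq_top_of_card_eq_finrank' (by simp)⟩
end

section
/- Let n > 2 be an odd integer and let K be a field that contains a primitive m-th root of unity for every odd m ≤ n. Then OBC_n(K) is false: for every family of functions s_1,…,s_n, where s_i maps an i × n array of vectors of K^n to a permutation of {1,…,n}, there exists an n × n array (v_{ij}) of vectors in K^n whose rows are all bases of K^n such that, setting π_i := s_i(v_{1•},…,v_{i•}), some column j of the rearranged array, i.e. the list v_{1,π_1(j)}, …, v_{n,π_n(j)}, fails to be a basis of K^n. -/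
lemma latin_extend {ι : Type} [Fintype ι] {n : ℕ} (hc : Fintype.card ι < n)
    (P : ι → Equiv.Perm (Fin n)) (hP : ∀ j, Function.Injective (fun i => P i j)) :
    ∃ α : Equiv.Perm (Fin n), ∀ i j, P i j ≠ α j := by
  classical
  have key := (Fintype.all_card_le_filter_rel_iff_exists_injective
    (fun (j x : Fin n) => ∀ i, P i j ≠ x)).1 (by
      intro A
      have h := Finset.card_mul_le_card_mul (fun (j x : Fin n) => ∀ i, P i j ≠ x)
        (s := A) (t := Finset.univ.filter (fun x => ∃ a ∈ A, ∀ i, P i a ≠ x))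
        (m := n - Fintype.card ι) (n := n - Fintype.card ι)
        (by
          intro a ha
          have h1 : Finset.bipartiteAbove (fun (j x : Fin n) => ∀ i, P i j ≠ x)
              (Finset.univ.filter (fun x => ∃ a ∈ A, ∀ i, P i a ≠ x)) a
              = (Finset.univ.image (fun i => P i a))ᶜ := by
            ext x
            simp only [Finset.mem_bipartiteAbove, Finset.mem_filter, Finset.mem_univ, true_and,
              Finset.mem_compl, Finset.mem_image, not_exists]
            exact ⟨fun h => h.2, fun h => ⟨⟨a, ha, h⟩, h⟩⟩
          rw [h1, Finset.card_compl, Finset.card_image_of_injective _ (hP a), Fintype.card_fin,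
            Finset.card_univ])
        (by
          intro b hb
          have h1 : Finset.bipartiteBelow (fun (j x : Fin n) => ∀ i, P i j ≠ x) A b
              ⊆ (Finset.univ.image (fun i => (P i).symm b))ᶜ := by
            intro x
            simp only [Finset.mem_bipartiteBelow, Finset.mem_univ, true_and,
              Finset.mem_compl, Finset.mem_image, not_exists]
            rintro ⟨_, h⟩ i rfl
            exact h i (by simp)
          refine (Finset.card_le_card h1).trans ?_
          rw [Finset.card_compl, Finset.card_image_of_injective, Fintype.card_fin,
            Finset.card_univ]
          intro i i' h
          simp only at h
          apply hP ((P i).symm b)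
          simp only
          conv_rhs => rw [h]
          simp)
      have h' := Nat.le_of_mul_le_mul_right h (Nat.sub_pos_of_lt hc)
      convert h')
  obtain ⟨f, hf, hf2⟩ := key
  refine ⟨Equiv.ofBijective f (Finite.injective_iff_bijective.1 hf), fun i j => ?_⟩
  exact hf2 j i

lemma odd_cycle {n : ℕ} (hodd : Odd n) (σ : Equiv.Perm (Fin n)) (hσ : ∀ x, σ x ≠ x) :
    ∃ (M : ℕ) (g : Fin (M + 1) → Fin n), Odd (M + 1) ∧ M + 1 ≤ n ∧ Function.Injective g ∧
      ∀ t, σ (g t) = g (t + 1) := by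
  classical
  have hs : σ.support.card = n := by
    have : σ.support = Finset.univ := by ext x; simp [hσ]
    rw [this]; simp
  obtain ⟨m, hm, hmo⟩ : ∃ m ∈ σ.cycleType, Odd m := by
    by_contra! h
    have : 2 ∣ σ.cycleType.sum := Multiset.dvd_sum (fun m hm => by
      have := h m hm
      rw [Nat.not_odd_iff_even] at this
      exact this.two_dvd)
    rw [Equiv.Perm.sum_cycleType, hs] at this
    exact (Nat.not_even_iff_odd.2 hodd) (even_iff_two_dvd.2 this)
  obtain ⟨c, τ, rfl, hd, hc, hcard⟩ := Equiv.Perm.mem_cycleType_iff.1 hm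
  obtain ⟨M, rfl⟩ : ∃ M, m = M + 1 := ⟨m - 1, by have := hmo.pos; omega⟩
  have hord : orderOf c = M + 1 := by rw [hc.orderOf, hcard]
  obtain ⟨x, hx⟩ := hc.nonempty_support
  have hx' : c x ≠ x := by simpa using hx
  refine ⟨M, fun t => (c ^ (t : ℕ)) x, hmo, ?_, ?_, ?_⟩
  · rw [← hcard]; exact (Finset.card_le_univ _).trans (by simp)
  · have main : ∀ a b : ℕ, a ≤ b → b < M + 1 → (c ^ a) x = (c ^ b) x → a = b := by
      intro a b hab hb h
      obtain ⟨k, rfl⟩ := Nat.exists_eq_add_of_le hab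
      rw [pow_add, Equiv.Perm.mul_apply] at h
      have h2 := (c ^ a).injective h
      have h3 : c ^ k = 1 := hc.pow_eq_one_iff.2 ⟨x, hx', h2.symm⟩
      have h4 := orderOf_dvd_of_pow_eq_one h3
      rw [hord] at h4
      have := Nat.eq_zero_of_dvd_of_lt h4 (by omega)
      omega
    intro a b h
    ext
    rcases le_total (a : ℕ) b with hab | hab
    · exact main a b hab b.2 h
    · exact (main b a hab a.2 h.symm).symm
  · intro t
    have h1 : (c * τ) ((c ^ (t : ℕ)) x) = (c ^ ((t : ℕ) + 1)) x := by
      rw [Equiv.Perm.mul_apply, pow_succ', Equiv.Perm.mul_apply]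
      congr 1
      rcases hd ((c ^ (t : ℕ)) x) with h | h
      · exfalso
        apply hx'
        rw [← Equiv.Perm.mul_apply, ← pow_succ', pow_succ, Equiv.Perm.mul_apply] at h
        exact (c ^ (t : ℕ)).injective h
      · exact h
    simp only
    rw [h1, Fin.val_add_one]
    split_ifs with h
    · subst h
      rw [Fin.val_last, ← hord, pow_orderOf_eq_one, pow_zero]
    · rfl

section lin
variable {K : Type*} [Field K] {n M : ℕ}

/-- eigenvector row -/
noncomputable def rowW (g : Fin (M + 1) → Fin n) (ζ : K) : Fin n → Fin n → K :=
  Function.extend g (fun s => Function.extend g (fun t => ζ ^ ((s : ℕ) * (t : ℕ))) 0)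
    (fun k => Pi.single k 1)

lemma rowW_in {g : Fin (M + 1) → Fin n} (hg : Function.Injective g) (ζ : K) (s t) :
    rowW g ζ (g s) (g t) = ζ ^ ((s : ℕ) * (t : ℕ)) := by
  rw [rowW, hg.extend_apply, hg.extend_apply]

lemma rowW_in_out {g : Fin (M + 1) → Fin n} (hg : Function.Injective g) (ζ : K) (s x)
    (hx : ¬ ∃ t, g t = x) :
    rowW g ζ (g s) x = 0 := by
  rw [rowW, hg.extend_apply, Function.extend_apply' _ _ _ hx]; rfl

lemma rowW_out {g : Fin (M + 1) → Fin n} (ζ : K) (k)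
    (hx : ¬ ∃ t, g t = k) :
    rowW g ζ k = Pi.single k 1 := by
  rw [rowW, Function.extend_apply' _ _ _ hx]

lemma rowW_step {g : Fin (M + 1) → Fin n} (hg : Function.Injective g) {ζ : K}
    (hζ : IsPrimitiveRoot ζ (M + 1)) (s t) :
    rowW g ζ (g s) (g (t + 1)) = ζ ^ (s : ℕ) * rowW g ζ (g s) (g t) := by
  rw [rowW_in hg, rowW_in hg, Fin.val_add_one, ← pow_add]
  split_ifs with h
  · subst h
    rw [Fin.val_last, show (s : ℕ) + s * M = (M + 1) * s by ring, pow_mul ζ (M + 1),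
      hζ.pow_eq_one]
    simp
  · congr 1; ring

lemma rowW_li {g : Fin (M + 1) → Fin n} (hg : Function.Injective g) {ζ : K}
    (hζ : IsPrimitiveRoot ζ (M + 1)) : LinearIndependent K (rowW g ζ) := by
  rw [Fintype.linearIndependent_iff]
  intro c hc
  have hout : ∀ k, (¬ ∃ t, g t = k) → c k = 0 := by
    intro k hk
    have h := congrFun hc k
    rw [Finset.sum_apply, Finset.sum_eq_single k] at h
    · simpa [rowW_out ζ k hk] using h
    · intro b _ hb
      by_cases hb' : ∃ t, g t = b
      · obtain ⟨t, rfl⟩ := hb'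
        simp [rowW_in_out hg ζ t k hk]
      · simp [rowW_out ζ b hb', Pi.single_apply, hb.symm]
    · simp
  have hin : (fun s => c (g s)) = 0 := by
    have hdet : (Matrix.vandermonde (fun s : Fin (M + 1) => ζ ^ (s : ℕ))).det ≠ 0 := by
      rw [Matrix.det_vandermonde_ne_zero_iff]
      intro a b h
      ext
      exact hζ.pow_inj a.2 b.2 h
    apply Matrix.eq_zero_of_vecMul_eq_zero hdet
    ext t
    have h := congrFun hc (g t)
    rw [Finset.sum_apply, ← Fintype.sum_of_injective g hg
      (fun s => c (g s) * ζ ^ ((s : ℕ) * (t : ℕ)))] at h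
    · rw [Pi.zero_apply] at h ⊢
      rw [← h]
      simp only [Matrix.vecMul, dotProduct, Matrix.vandermonde_apply, pow_mul]
    · intro i hi
      simp [hout i hi]
    · intro i
      simp [rowW_in hg]
  intro k
  by_cases hk : ∃ t, g t = k
  · obtain ⟨t, rfl⟩ := hk
    exact congrFun hin t
  · exact hout k hk

/-- last row -/
noncomputable def rowU (g : Fin (M + 1) → Fin n) (d : ℕ → K) : Fin n → Fin n → K :=
  Function.update (fun k => Pi.single k 1) (g 0)
    (Function.extend g (fun t => ∏ l ∈ Finset.range t, d l) 0)

lemma rowU_step {g : Fin (M + 1) → Fin n} (hg : Function.Injective g) (d : ℕ → K)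
    (hd : ∏ l ∈ Finset.range (M + 1), d l = 1) (k) (hk : k = g 0 ∨ ¬ ∃ t, g t = k)
    (t : Fin (M + 1)) :
    rowU g d k (g (t + 1)) = d t * rowU g d k (g t) := by
  by_cases h0 : k = g 0
  · subst h0
    rw [rowU, Function.update_self, hg.extend_apply, hg.extend_apply, Fin.val_add_one]
    split_ifs with h
    · subst h
      rw [Fin.val_last, mul_comm, ← Finset.prod_range_succ, hd]; simp
    · rw [Finset.prod_range_succ, mul_comm]
  · have hk' := hk.resolve_left h0
    have h1 : ∀ t, g t ≠ k := fun t h => hk' ⟨t, h⟩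
    rw [rowU, Function.update_of_ne h0]
    simp [Pi.single_apply, h1]

lemma rowU_li {g : Fin (M + 1) → Fin n} (hg : Function.Injective g) (d : ℕ → K) :
    LinearIndependent K (rowU g d) := by
  rw [Fintype.linearIndependent_iff]
  intro c hc
  have hne : ∀ k, k ≠ g 0 → rowU g d k = Pi.single k 1 := fun k h => by
    rw [rowU, Function.update_of_ne h]
  have h0 : c (g 0) = 0 := by
    have h := congrFun hc (g 0)
    rw [Finset.sum_apply, Finset.sum_eq_single (g 0)] at h
    · rw [rowU, Pi.smul_apply, Function.update_self, hg.extend_apply] at h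
      simpa using h
    · intro b _ hb
      simp [hne b hb, Pi.single_apply, hb.symm]
    · simp
  intro k
  by_cases hk : k = g 0
  · rw [hk, h0]
  have h := congrFun hc k
  rw [Finset.sum_apply, Finset.sum_eq_single k] at h
  · simpa [hne k hk] using h
  · intro b _ hb
    by_cases hb' : b = g 0
    · rw [hb', h0]; simp
    · simp [hne b hb', Pi.single_apply, hb.symm]
  · simp

lemma single_li : LinearIndependent K (fun k : Fin n => (Pi.single k 1 : Fin n → K)) :=
  Pi.linearIndependent_single_one (Fin n) K

lemma row_basis {v : Fin n → Fin n → K} (h : LinearIndependent K v) :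
    LinearIndependent K v ∧ Submodule.span K (Set.range v) = ⊤ :=
  ⟨h, h.span_eq_top_of_card_eq_finrank' (by simp)⟩

/-- the array -/
def arr {N : ℕ} (w u : Fin (N + 2) → Fin (N + 2) → K) : Fin (N + 2) → Fin (N + 2) → Fin (N + 2) → K :=
  fun i => if (i : ℕ) < N then fun k => Pi.single k 1 else if (i : ℕ) = N then w else u

end lin

lemma prod_pow_perm {K : Type*} [Field K] {M : ℕ} (ho : Odd (M + 1)) {ζ : K}
    (hζ : IsPrimitiveRoot ζ (M + 1)) (κ : Fin (M + 1) → Fin (M + 1))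
    (hκ : Function.Bijective κ) : ∏ t, ζ ^ (κ t : ℕ) = 1 := by
  rw [hκ.prod_comp (fun s => ζ ^ (s : ℕ)), Fin.prod_univ_eq_prod_range (fun i => ζ ^ i),
    Finset.prod_pow_eq_pow_sum]
  obtain ⟨r, hr⟩ := ho
  have h := Finset.sum_range_id_mul_two (M + 1)
  have : ∑ i ∈ Finset.range (M + 1), i = (M + 1) * r := by
    rw [show M + 1 - 1 = 2 * r by omega] at h
    nlinarith
  rw [this, pow_mul, hζ.pow_eq_one, one_pow]

/-- For odd `n > 2` and a field `K` containing a primitive `m`-th root of unity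
for every odd `m ≤ n`, the online version `OBC_n(K)` of Rota's basis conjecture
fails: every family of online strategies `s i` (where `s i` sees only rows
`0, …, i` and outputs the permutation to be applied to row `i`) can be fooled
by some array whose rows are bases but for which some column of the rearranged
array is not a basis. -/
theorem online_rota_fails_in_odd_dimension
    (n : ℕ) (hn : 2 < n) (hodd : Odd n) (K : Type*) [Field K]
    (hprim : ∀ m : ℕ, Odd m → m ≤ n → ∃ ζ : K, IsPrimitiveRoot ζ m) :
    ∀ s : (i : Fin n) → (Fin ((i : ℕ) + 1) → Fin n → (Fin n → K)) → Equiv.Perm (Fin n),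
      ∃ v : Fin n → Fin n → (Fin n → K),
        (∀ i, LinearIndependent K (v i) ∧
          Submodule.span K (Set.range (v i)) = ⊤) ∧
        ∃ j, ¬ (LinearIndependent K
            (fun i => v i (s i (fun k => v (Fin.castLE i.isLt k)) j)) ∧
          Submodule.span K
            (Set.range fun i => v i (s i (fun k => v (Fin.castLE i.isLt k)) j)) = ⊤) := by
  intro s
  obtain ⟨N, rfl⟩ : ∃ N, n = N + 2 := ⟨n - 2, by omega⟩
  set e : Fin (N + 2) → Fin (N + 2) → K := fun k => Pi.single k 1 with he
  have hrows : ∀ w u : Fin (N + 2) → Fin (N + 2) → K, LinearIndependent K w →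
      LinearIndependent K u → ∀ i, LinearIndependent K (arr w u i) ∧
          Submodule.span K (Set.range (arr w u i)) = ⊤ := by
    intro w u hw hu i
    apply row_basis
    unfold arr
    split_ifs
    · exact single_li
    · exact hw
    · exact hu
  let iN : Fin (N + 2) := ⟨N, by omega⟩
  let iL : Fin (N + 2) := ⟨N + 1, by omega⟩
  let P : Fin N → Equiv.Perm (Fin (N + 2)) := fun i => s (i.castLE (by omega)) (fun _ => e)
  have hlow : ∀ w u, ∀ i : Fin (N + 2), ∀ h : (i : ℕ) < N,
      s i (fun k => arr w u (Fin.castLE i.isLt k)) = P ⟨i, h⟩ := by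
    intro w u i h
    show _ = s i _
    congr 1
    funext k
    have : (k : ℕ) < N := by have := k.2; omega
    simp [arr, this, he]
  have hlowv : ∀ w u, ∀ i : Fin (N + 2), (i : ℕ) < N → arr w u i = e := by
    intro w u i h
    simp [arr, h, he]
  have hNv : ∀ w u : Fin (N + 2) → Fin (N + 2) → K, arr w u iN = w := by
    intro w u; simp [arr, iN]
  have hLv : ∀ w u : Fin (N + 2) → Fin (N + 2) → K, arr w u iL = u := by
    intro w u; simp [arr, iL]
  have hmid : ∀ w u u' : Fin (N + 2) → Fin (N + 2) → K,
      s iN (fun k => arr w u (Fin.castLE iN.isLt k)) =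
      s iN (fun k => arr w u' (Fin.castLE iN.isLt k)) := by
    intro w u u'
    congr 1
    funext k
    have h1 : (k : ℕ) < N + 1 := k.2
    by_cases h : (k : ℕ) < N
    · simp [arr, h]
    · have : (k : ℕ) = N := by omega
      simp [arr, this]
  by_cases hinj : ∀ j, Function.Injective (fun i => P i j)
  swap
  · push Not at hinj
    obtain ⟨j, hj⟩ := hinj
    simp only [Function.Injective, not_forall] at hj
    obtain ⟨a, b, hab, hne⟩ := hj
    refine ⟨arr e e, hrows e e single_li single_li, j, fun h => ?_⟩
    have hi := h.1.injective
    have ha : ((a.castLE (by omega) : Fin (N + 2)) : ℕ) < N := a.2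
    have hb : ((b.castLE (by omega) : Fin (N + 2)) : ℕ) < N := b.2
    have := @hi (a.castLE (by omega)) (b.castLE (by omega)) (by
      simp only
      rw [hlow _ _ _ ha, hlow _ _ _ hb, hlowv _ _ _ ha, hlowv _ _ _ hb]
      exact congrArg e hab)
    exact hne (by simpa [Fin.ext_iff] using this)
  obtain ⟨α, hα⟩ := latin_extend (by simp) P hinj
  obtain ⟨β, hβ⟩ := latin_extend (ι := Option (Fin N)) (n := N + 2) (by simp)
    (fun o => o.elim α P) (by
      intro j a b h
      rcases a with _ | a <;> rcases b with _ | b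
      · rfl
      · exact absurd h.symm (hα b j)
      · exact absurd h (hα a j)
      · exact congrArg some (hinj j h))
  have hαβ : ∀ j, α j ≠ β j := fun j => hβ none j
  have hPβ : ∀ i j, P i j ≠ β j := fun i j => hβ (some i) j
  have hcover : ∀ j k, k ≠ α j → k ≠ β j → ∃ i, P i j = k := by
    intro j k h1 h2
    have hI : Finset.univ.image (fun i => P i j) = ({α j, β j} : Finset (Fin (N + 2)))ᶜ := by
      apply Finset.eq_of_subset_of_card_le
      · intro x
        simp only [Finset.mem_image, Finset.mem_univ, true_and, Finset.mem_compl,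
          Finset.mem_insert, Finset.mem_singleton, not_or]
        rintro ⟨i, rfl⟩
        exact ⟨hα i j, hPβ i j⟩
      · rw [Finset.card_compl, Finset.card_pair (hαβ j), Finset.card_image_of_injective _ (hinj j)]
        simp
    have : k ∈ Finset.univ.image (fun i => P i j) := by
      rw [hI]; simp [h1, h2]
    simpa using this
  obtain ⟨M, g, hMo, hMn, hg, hstep⟩ := odd_cycle hodd (α.symm.trans β) (by
    intro x h
    apply hαβ (α.symm x)
    simpa using h.symm)
  obtain ⟨ζ, hζ⟩ := hprim (M + 1) hMo hMn
  have hβg : ∀ t, β (α.symm (g t)) = g (t + 1) := hstep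
  have hgne : ∀ t, g t ≠ g (t + 1) := by
    intro t h
    apply hαβ (α.symm (g t))
    rw [hβg, ← h]; simp
  set w := rowW g ζ with hw
  have hwli : LinearIndependent K w := rowW_li hg hζ
  let Q := s iN (fun k => arr w e (Fin.castLE iN.isLt k))
  by_cases hQ : ∀ t, ∃ r, g r = Q (α.symm (g t))
  swap
  · push Not at hQ
    obtain ⟨t, ht⟩ := hQ
    refine ⟨arr w e, hrows w e hwli single_li, α.symm (g t), fun h => ?_⟩
    obtain ⟨i, hi⟩ := hcover (α.symm (g t)) (Q (α.symm (g t)))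
      (by simpa using (ht t).symm) (by rw [hβg]; exact (ht _).symm)
    have ha : ((i.castLE (by omega) : Fin (N + 2)) : ℕ) < N := i.2
    have hinj2 := h.1.injective
    have := @hinj2 (i.castLE (by omega)) iN (by
      simp only
      rw [hlow _ _ _ ha, hlowv _ _ _ ha, hNv]
      show e (P i _) = w (Q _)
      rw [hi, hw, rowW_out]
      push Not
      exact ht)
    have h2 := congrArg Fin.val this
    simp [iN] at h2
    have := i.2
    omega
  choose κ hκ using hQ
  have hκi : Function.Injective κ := by
    intro a b h
    have : g (κ a) = g (κ b) := by rw [h]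
    rw [hκ, hκ] at this
    exact hg (α.symm.injective (Q.injective this))
  have hprod := prod_pow_perm hMo hζ κ (Finite.injective_iff_bijective.1 hκi)
  let d : ℕ → K := fun l => ζ ^ (κ (Fin.ofNat (M + 1) l) : ℕ)
  have hdt : ∀ t : Fin (M + 1), d t = ζ ^ (κ t : ℕ) := by
    intro t; simp [d]
  have hd : ∏ l ∈ Finset.range (M + 1), d l = 1 := by
    rw [← Fin.prod_univ_eq_prod_range, ← hprod]
    exact Finset.prod_congr rfl fun t _ => hdt t
  set u := rowU g d with hu
  have huli : LinearIndependent K u := rowU_li hg d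
  refine ⟨arr w u, hrows w u hwli huli, ?_⟩
  let R := s iL (fun k => arr w u (Fin.castLE iL.isLt k))
  obtain ⟨t, ht⟩ : ∃ t, R (α.symm (g t)) = g 0 ∨ ¬ ∃ r, g r = R (α.symm (g t)) := by
    by_contra! hcon
    choose ρ hρ using fun t => (hcon t).2
    have hρi : Function.Injective ρ := by
      intro a b h
      have : g (ρ a) = g (ρ b) := by rw [h]
      rw [hρ, hρ] at this
      exact hg (α.symm.injective (R.injective this))
    obtain ⟨t, ht⟩ := (Finite.injective_iff_surjective.1 hρi) 0
    apply (hcon t).1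
    rw [← hρ, ht]
  refine ⟨α.symm (g t), fun h => ?_⟩
  let φ : (Fin (N + 2) → K) →ₗ[K] K :=
    LinearMap.proj (g (t + 1)) - d t • LinearMap.proj (g t)
  have hφ : ∀ x, φ x = x (g (t + 1)) - d t * x (g t) := fun x => by simp [φ]
  have hle : Submodule.span K (Set.range fun i => arr w u i
      (s i (fun k => arr w u (Fin.castLE i.isLt k)) (α.symm (g t)))) ≤ LinearMap.ker φ := by
    rw [Submodule.span_le]
    rintro _ ⟨i, rfl⟩
    simp only [SetLike.mem_coe, LinearMap.mem_ker]
    rw [hφ, sub_eq_zero]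
    by_cases hi : (i : ℕ) < N
    · rw [hlow _ _ _ hi, hlowv _ _ _ hi]
      have h1 := hα ⟨i, hi⟩ (α.symm (g t))
      have h2 := hPβ ⟨i, hi⟩ (α.symm (g t))
      rw [hβg] at h2
      rw [Equiv.apply_symm_apply] at h1
      simp [he, Pi.single_apply, h1.symm, h2.symm]
    · by_cases hi' : (i : ℕ) = N
      · obtain rfl : i = iN := Fin.ext hi'
        rw [hNv, hmid w u e]
        show w (Q _) _ = _ * w (Q _) _
        rw [← hκ, hdt]
        exact rowW_step hg hζ _ _
      · obtain rfl : i = iL := Fin.ext (by have := i.2; simp only [iL]; omega)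
        rw [hLv]
        exact rowU_step hg d hd _ ht t
  rw [h.2] at hle
  have h1 : φ (Pi.single (g (t + 1)) 1) = 0 := hle (Submodule.mem_top)
  rw [hφ] at h1
  simp [Pi.single_apply, hgne t] at h1
end

section
/- Let n ≥ 4 be an even integer and let K be a field of characteristic different from 2. Then for every 3 × n array (v_{ij}) of vectors in K^n whose three rows are each bases of K^n, there exist permutations π_1, π_2, π_3 of {1,…,n} such that for every j = 1,…,n the three vectors v_{1,π_1(j)}, v_{2,π_2(j)}, v_{3,π_3(j)} are linearly independent. -/
theorem aux_li3 {K V : Type*} [Field K] [AddCommGroup V] [Module K V] {x y z : V}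
    (h : LinearIndependent K ![x, y]) (hz : z ∉ Submodule.span K {x, y}) :
    LinearIndependent K ![z, x, y] := by
  have := (linearIndependent_finCons (K := K) (x := z) (v := ![x, y])).2
    ⟨h, by simpa [Matrix.range_cons, Set.pair_comm] using hz⟩
  exact this

theorem aux_A {K V : Type*} [Field K] [AddCommGroup V] [Module K V] {x y z p q : V}
    (h : LinearIndependent K ![x, y, z]) (hx : x ∈ Submodule.span K {p, q})
    (hy : y ∈ Submodule.span K {p, q}) (hz : z ∈ Submodule.span K {p, q}) : False := by
  classical
  have h2 : Submodule.span K (Set.range ![x, y, z]) ≤ Submodule.span K {p, q} := by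
    rw [Submodule.span_le]
    rintro _ ⟨i, rfl⟩
    fin_cases i <;> simpa
  have hf : FiniteDimensional K (Submodule.span K ({p, q} : Set V)) :=
    FiniteDimensional.span_of_finite K (by simp)
  have h3 := Submodule.finrank_mono h2
  rw [finrank_span_eq_card h] at h3
  have h4 := finrank_span_finset_le_card (R := K) ({p, q} : Finset V)
  have h5 : ({p, q} : Finset V).card ≤ 2 := Finset.card_le_two
  simp only [Finset.coe_insert, Finset.coe_singleton] at h4
  simp only [Fintype.card_fin] at h3
  unfold Set.finrank at h4
  omega

theorem aux_B {K V : Type*} [Field K] [AddCommGroup V] [Module K V] {x y z p q : V}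
    (h : LinearIndependent K ![x, y]) (hx : x ∈ Submodule.span K {p, q})
    (hy : y ∈ Submodule.span K {p, q}) (hz : z ∈ Submodule.span K {p, q}) :
    z ∈ Submodule.span K {x, y} := by
  by_contra hc
  exact aux_A (aux_li3 h hc) hz hx hy

theorem aux_B' {K V : Type*} [Field K] [AddCommGroup V] [Module K V] {x y p q : V}
    (h : LinearIndependent K ![x, y]) (hx : x ∈ Submodule.span K {p, q})
    (hy : y ∈ Submodule.span K {p, q}) :
    p ∈ Submodule.span K {x, y} ∧ q ∈ Submodule.span K {x, y} :=
  ⟨aux_B h hx hy (Submodule.subset_span (by simp)),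
    aux_B h hx hy (Submodule.subset_span (by simp))⟩

theorem aux_pair {K V : Type*} [Field K] [AddCommGroup V] [Module K V] {ι : Type*} {a : ι → V}
    (h : LinearIndependent K a) {i j : ι} (hij : i ≠ j) : LinearIndependent K ![a i, a j] := by
  have := h.comp ![i, j] (by
    intro s t; fin_cases s <;> fin_cases t <;> simp [hij, hij.symm])
  convert this using 1
  funext s; fin_cases s <;> rfl

theorem aux_triple {K V : Type*} [Field K] [AddCommGroup V] [Module K V] {ι : Type*} {a : ι → V}
    (h : LinearIndependent K a) {i j k : ι} (hij : i ≠ j) (hik : i ≠ k) (hjk : j ≠ k) :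
    LinearIndependent K ![a i, a j, a k] := by
  have := h.comp ![i, j, k] (by
    intro s t; fin_cases s <;> fin_cases t <;>
      simp [hij, hij.symm, hik, hik.symm, hjk, hjk.symm])
  convert this using 1
  funext s; fin_cases s <;> rfl

theorem aux_notpair {K V : Type*} [Field K] [AddCommGroup V] [Module K V] {x y : V}
    (hx : x ≠ 0) (h : ¬ LinearIndependent K ![x, y]) : y ∈ Submodule.span K {x} := by
  rw [LinearIndependent.pair_iff' hx] at h
  push Not at h
  exact Submodule.mem_span_singleton.2 h

theorem aux_pair_of_mem {K V : Type*} [Field K] [AddCommGroup V] [Module K V] {x y : V}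
    (P : Submodule K V) (hx : x ≠ 0) (hP : x ∈ P) (hy : y ∉ P) :
    LinearIndependent K ![x, y] := by
  by_contra h
  have := aux_notpair hx h
  exact hy ((Submodule.span_le.2 (by simpa using hP) : Submodule.span K {x} ≤ P) this)

theorem aux_inter {K V : Type*} [Field K] [AddCommGroup V] [Module K V] {x y c : V}
    (P : Submodule K V) (hP : x ∈ P) (hy : y ∉ P) (hc : c ∈ P)
    (h : c ∈ Submodule.span K {x, y}) : ∃ s : K, c = s • x := by
  obtain ⟨s, t, rfl⟩ := Submodule.mem_span_pair.1 h
  by_cases ht : t = 0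
  · exact ⟨s, by simp [ht]⟩
  · exfalso
    apply hy
    have h1 : t • y ∈ P := by
      have := P.sub_mem hc (P.smul_mem s hP)
      simpa using this
    exact (P.smul_mem_iff ht).1 h1

theorem aux_hall (n : ℕ) (hn : 4 ≤ n) (F : Fin n → Fin n → Prop)
    (h1 : ∀ i p q r, p ≠ q → p ≠ r → q ≠ r → F i p → F i q → F i r → False)
    (h2 : ∀ p q, p ≠ q → ∀ i j k, i ≠ j → i ≠ k → j ≠ k →
      F i p → F i q → F j p → F j q → F k p → F k q → False)
    (h3 : ∀ p, ∃ i, ¬ F i p) : ∃ σ : Equiv.Perm (Fin n), ∀ i, ¬ F i (σ i) := by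
  classical
  let t : Fin n → Finset (Fin n) := fun i => Finset.univ.filter (fun k => ¬ F i k)
  obtain ⟨f, hf, hft⟩ := (Finset.all_card_le_biUnion_card_iff_exists_injective t).1 (by
    intro s
    have hc := Finset.card_add_card_compl (s.biUnion t)
    rw [Fintype.card_fin] at hc
    have hmem : ∀ k ∈ (s.biUnion t)ᶜ, ∀ i ∈ s, F i k := by
      intro k hk i hi
      by_contra hF
      rw [Finset.mem_compl] at hk
      exact hk (Finset.mem_biUnion.2 ⟨i, hi, by simp [t, hF]⟩)
    have hs : s.card ≤ n := by simpa using Finset.card_le_univ s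
    rcases s.eq_empty_or_nonempty with rfl | ⟨i0, hi0⟩
    · simp
    have hle2 : (s.biUnion t)ᶜ.card ≤ 2 := by
      by_contra hlt
      obtain ⟨p, q, r, hp, hq, hr, hpq, hpr, hqr⟩ := Finset.two_lt_card_iff.1 (not_le.1 hlt)
      exact h1 i0 p q r hpq hpr hqr (hmem p hp i0 hi0) (hmem q hq i0 hi0) (hmem r hr i0 hi0)
    by_cases hs2 : 2 < s.card
    · obtain ⟨i, j, k, hi, hj, hk, hij, hik, hjk⟩ := Finset.two_lt_card_iff.1 hs2
      have hle1 : (s.biUnion t)ᶜ.card ≤ 1 := by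
        by_contra hlt
        obtain ⟨p, hp, q, hq, hpq⟩ := Finset.one_lt_card.1 (not_le.1 hlt)
        exact h2 p q hpq i j k hij hik hjk (hmem p hp i hi) (hmem q hq i hi)
          (hmem p hp j hj) (hmem q hq j hj) (hmem p hp k hk) (hmem q hq k hk)
      by_cases hsn : s.card = n
      · have hsu : s = Finset.univ := Finset.card_eq_iff_eq_univ s |>.1 (by simpa using hsn)
        have : (s.biUnion t)ᶜ = ∅ := by
          rw [Finset.eq_empty_iff_forall_notMem]
          intro k hk
          obtain ⟨i, hi⟩ := h3 k
          exact hi (hmem k hk i (by simp [hsu]))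
        rw [this, Finset.card_empty] at hc
        omega
      · omega
    · omega)
  refine ⟨Equiv.ofBijective f (Finite.injective_iff_bijective.1 hf), fun i => ?_⟩
  have := hft i
  simpa [t] using this

/-- The pairing of `a` with `b` is valid and no `c k` lies in all planes. -/
theorem aux_main {K V : Type*} [Field K] [AddCommGroup V] [Module K V] (n : ℕ) (hn : 4 ≤ n)
    (a b c : Fin n → V) (ha : LinearIndependent K a) (hb : LinearIndependent K b)
    (hc : LinearIndependent K c) (hab : ∀ i, LinearIndependent K ![a i, b i]) :
    ∃ σ : Equiv.Perm (Fin n), (∀ i, LinearIndependent K ![a i, b (σ i)]) ∧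
      ∀ k, ∃ i, c k ∉ Submodule.span K {a i, b (σ i)} := by
  classical
  by_cases h0 : ∀ k, ∃ i, c k ∉ Submodule.span K {a i, b i}
  · exact ⟨Equiv.refl _, hab, h0⟩
  push Not at h0
  obtain ⟨m, hm⟩ := h0
  have ha0 := ha.ne_zero
  have hb0 := hb.ne_zero
  have hc0 := hc.ne_zero m
  -- good indices
  have hgood : ∃ i0, ∀ i, i ≠ i0 → a i ∈ Submodule.span K {c m, b i} := by
    by_cases hg : ∀ i, a i ∈ Submodule.span K {c m, b i}
    · exact ⟨⟨0, by omega⟩, fun i _ => hg i⟩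
    push Not at hg
    obtain ⟨i0, hi0⟩ := hg
    have key : ∀ i, a i ∉ Submodule.span K {c m, b i} → ∃ t : K, c m = t • b i := by
      intro i hi
      exact aux_inter (Submodule.span K {c m, b i}) (Submodule.subset_span (by simp)) hi
        (Submodule.subset_span (by simp)) (by rw [Set.pair_comm]; exact hm i)
    refine ⟨i0, fun i hne => ?_⟩
    by_contra hi
    obtain ⟨t, ht⟩ := key i hi
    obtain ⟨s, hs⟩ := key i0 hi0
    have := LinearIndependent.pair_iff.1 (aux_pair hb hne) t (-s) (by
      rw [← ht, neg_smul, ← hs]; simp)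
    apply hc0
    rw [ht, this.1, zero_smul]
  obtain ⟨i0, hi0⟩ := hgood
  have hkl : ∃ k l, k ≠ l ∧ k ≠ i0 ∧ l ≠ i0 ∧ c m ∉ Submodule.span K {a k, a l} := by
    have hcard : 2 < (Finset.univ.erase i0).card := by
      rw [Finset.card_erase_of_mem (Finset.mem_univ _)]; simp; omega
    obtain ⟨p, q, r, hp, hq, hr, hpq, hpr, hqr⟩ := Finset.two_lt_card_iff.1 hcard
    simp only [Finset.mem_erase, Finset.mem_univ, and_true] at hp hq hr
    by_contra hno
    push Not at hno
    have e1 := hno p q hpq hp hq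
    have e2 := hno p r hpr hp hr
    have e3 := hno q r hqr hq hr
    have hT := aux_triple ha hpq hpr hqr
    have hr' : a r ∉ Submodule.span K {a p, a q} := fun h =>
      aux_A hT (Submodule.subset_span (by simp)) (Submodule.subset_span (by simp)) h
    obtain ⟨s, hs⟩ := aux_inter (Submodule.span K {a p, a q}) (Submodule.subset_span (by simp))
      hr' e1 e2
    obtain ⟨t, ht⟩ := aux_inter (Submodule.span K {a p, a q}) (Submodule.subset_span (by simp))
      hr' e1 e3
    have := LinearIndependent.pair_iff.1 (aux_pair ha hpq) s (-t) (by
      rw [← hs, neg_smul, ← ht]; simp)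
    apply hc0
    rw [hs, this.1, zero_smul]
  obtain ⟨k, l, hkl, hk, hl, hcn⟩ := hkl
  have hT := aux_li3 (aux_pair ha hkl) hcn
  have gk := hi0 k hk
  have gl := hi0 l hl
  have f1 : c m ∉ Submodule.span K {a k, b l} := by
    intro h
    refine aux_A hT h (Submodule.subset_span (by simp)) ?_
    refine (Submodule.span_le.2 ?_ : Submodule.span K {c m, b l} ≤ _) gl
    rintro _ (rfl | rfl)
    · exact h
    · exact Submodule.subset_span (by simp)
  have f2 : LinearIndependent K ![a k, b l] := by
    by_contra h
    have h := aux_notpair (ha0 k) h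
    refine aux_A (p := c m) (q := a k) hT (Submodule.subset_span (by simp))
      (Submodule.subset_span (by simp)) ?_
    refine (Submodule.span_le.2 ?_ : Submodule.span K {c m, b l} ≤ _) gl
    rintro _ (rfl | rfl)
    · exact Submodule.subset_span (by simp)
    · exact Submodule.span_mono (by simp) h
  have f3 : LinearIndependent K ![a l, b k] := by
    by_contra h
    have h := aux_notpair (ha0 l) h
    refine aux_A (p := c m) (q := a l) hT (Submodule.subset_span (by simp)) ?_
      (Submodule.subset_span (by simp))
    refine (Submodule.span_le.2 ?_ : Submodule.span K {c m, b k} ≤ _) gk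
    rintro _ (rfl | rfl)
    · exact Submodule.subset_span (by simp)
    · exact Submodule.span_mono (by simp) h
  have hswap : ∀ k l, LinearIndependent K ![a k, b l] → LinearIndependent K ![a l, b k] →
      ∀ i, LinearIndependent K ![a i, b (Equiv.swap k l i)] := by
    intro k l f2 f3 i
    by_cases e1 : i = k
    · subst e1; simpa using f2
    by_cases e2 : i = l
    · subst e2; simpa using f3
    rw [Equiv.swap_apply_of_ne_of_ne e1 e2]; exact hab i
  by_cases h1 : ∀ k', ∃ i, c k' ∉ Submodule.span K {a i, b (Equiv.swap k l i)}
  · exact ⟨Equiv.swap k l, hswap k l f2 f3, h1⟩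
  push Not at h1
  obtain ⟨m', hm'⟩ := h1
  have hmm : m ≠ m' := by
    rintro rfl
    have := hm' k
    rw [Equiv.swap_apply_left] at this
    exact f1 this
  have hcard : 1 < ((Finset.univ.erase k).erase l).card := by
    rw [Finset.card_erase_of_mem (by simp [hkl.symm]),
      Finset.card_erase_of_mem (Finset.mem_univ _)]; simp; omega
  obtain ⟨p, hp, q, hq, hpq⟩ := Finset.one_lt_card.1 hcard
  simp only [Finset.mem_erase, Finset.mem_univ, and_true] at hp hq
  have hcc := aux_pair hc hmm
  have hp' := hm' p
  have hq' := hm' q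
  rw [Equiv.swap_apply_of_ne_of_ne hp.2 hp.1] at hp'
  rw [Equiv.swap_apply_of_ne_of_ne hq.2 hq.1] at hq'
  obtain ⟨ap, bp⟩ := aux_B' hcc (hm p) hp'
  obtain ⟨aq, bq⟩ := aux_B' hcc (hm q) hq'
  have ak : a k ∉ Submodule.span K {c m, c m'} := fun h =>
    aux_A (aux_triple ha hpq hp.2 hq.2) ap aq h
  have bk : b k ∉ Submodule.span K {c m, c m'} := fun h =>
    aux_A (aux_triple hb hpq hp.2 hq.2) bp bq h
  have g1 : LinearIndependent K ![b p, a k] := aux_pair_of_mem _ (hb0 p) bp ak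
  have g2 : LinearIndependent K ![a p, b k] := aux_pair_of_mem _ (ha0 p) ap bk
  refine ⟨Equiv.swap k p, hswap k p (LinearIndependent.pair_symm_iff.1 g1) g2, ?_⟩
  intro k'
  by_contra hno
  push Not at hno
  have w1 := hno k
  have w2 := hno p
  have w3 := hno q
  rw [Equiv.swap_apply_left] at w1
  rw [Equiv.swap_apply_right] at w2
  rw [Equiv.swap_apply_of_ne_of_ne hq.2 hpq.symm] at w3
  have w4 : c k' ∈ Submodule.span K {c m, c m'} := by
    refine (Submodule.span_le.2 ?_ : Submodule.span K {a q, b q} ≤ _) w3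
    rintro _ (rfl | rfl) <;> assumption
  obtain ⟨s, hs⟩ := aux_inter _ bp ak w4 (by rw [Set.pair_comm]; exact w1)
  obtain ⟨t, ht⟩ := aux_inter _ ap bk w4 w2
  have := LinearIndependent.pair_iff.1 (hab p) t (-s) (by
      rw [← ht, neg_smul, ← hs]; simp)
  apply hc.ne_zero k'
  rw [ht, this.1, zero_smul]

theorem aux_final {K V : Type*} [Field K] [AddCommGroup V] [Module K V] (n : ℕ) (hn : 4 ≤ n)
    (a b c : Fin n → V) (ha : LinearIndependent K a) (hb : LinearIndependent K b)
    (hc : LinearIndependent K c) :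
    ∃ σ τ : Equiv.Perm (Fin n), ∀ i, LinearIndependent K ![c (τ i), a i, b (σ i)] := by
  have sub : ∀ x y : V, Submodule.span K {x} ≤ Submodule.span K {x, y} := fun x y =>
    Submodule.span_mono (by simp)
  obtain ⟨σ, hσ⟩ := aux_hall n hn (fun i k => b k ∈ Submodule.span K {a i})
    (fun i p q r hpq hpr hqr h1 h2 h3 => aux_A (q := 0) (aux_triple hb hpq hpr hqr)
      (sub _ _ h1) (sub _ _ h2) (sub _ _ h3))
    (fun p q hpq i _ _ _ _ _ h1 h2 _ _ _ _ => by
      obtain ⟨s, hs⟩ := Submodule.mem_span_singleton.1 h1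
      obtain ⟨t, ht⟩ := Submodule.mem_span_singleton.1 h2
      have := LinearIndependent.pair_iff.1 (aux_pair hb hpq) t (-s) (by
        rw [← hs, ← ht, smul_smul, smul_smul, ← add_smul]; ring_nf; simp)
      exact hb.ne_zero q (by rw [← ht, this.1, zero_smul]))
    (fun p => by
      by_contra hno
      push Not at hno
      let i : Fin n := ⟨0, by omega⟩
      let j : Fin n := ⟨1, by omega⟩
      have hij : i ≠ j := by simp [i, j]
      obtain ⟨s, hs⟩ := Submodule.mem_span_singleton.1 (hno i)
      obtain ⟨t, ht⟩ := Submodule.mem_span_singleton.1 (hno j)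
      have := LinearIndependent.pair_iff.1 (aux_pair ha hij) s (-t) (by
        rw [hs, neg_smul, ht]; simp)
      exact hb.ne_zero p (by rw [← hs, this.1, zero_smul]))
  have hab : ∀ i, LinearIndependent K ![a i, (b ∘ σ) i] := by
    intro i
    by_contra h
    exact hσ i (aux_notpair (ha.ne_zero i) h)
  obtain ⟨ρ, hρ, hρ'⟩ := aux_main n hn a (b ∘ σ) c ha (hb.comp _ σ.injective) hc hab
  obtain ⟨τ, hτ⟩ := aux_hall n hn (fun i k => c k ∈ Submodule.span K {a i, (b ∘ σ) (ρ i)})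
    (fun i p q r hpq hpr hqr h1 h2 h3 => aux_A (aux_triple hc hpq hpr hqr) h1 h2 h3)
    (fun p q hpq i j k hij hik hjk h1 h2 h3 h4 h5 h6 =>
      aux_A (aux_triple ha hij hik hjk) (aux_B' (aux_pair hc hpq) h1 h2).1
        (aux_B' (aux_pair hc hpq) h3 h4).1 (aux_B' (aux_pair hc hpq) h5 h6).1)
    hρ'
  exact ⟨ρ.trans σ, τ, fun i => aux_li3 (hρ i) (hτ i)⟩


/-- For even `n ≥ 4` and a field `K` of characteristic different from `2`,
any `3 × n` array of vectors in `K^n` whose three rows are bases can be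
rearranged within its rows so that all `n` columns consist of three linearly
independent vectors. -/
theorem three_rows_independent_columns
    (n : ℕ) (hn : 4 ≤ n) (heven : Even n) (K : Type*) [Field K]
    (hchar : (2 : K) ≠ 0)
    (v : Fin 3 → Fin n → (Fin n → K))
    (hrows : ∀ i, LinearIndependent K (v i) ∧
      Submodule.span K (Set.range (v i)) = ⊤) :
    ∃ π : Fin 3 → Equiv.Perm (Fin n),
      ∀ j, LinearIndependent K (fun i : Fin 3 => v i (π i j)) := by

  obtain ⟨σ, τ, h⟩ := aux_final n hn (v 0) (v 1) (v 2) (hrows 0).1 (hrows 1).1 (hrows 2).1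
  refine ⟨![Equiv.refl _, σ, τ], fun j => ?_⟩
  have := (h j).comp ![1, 2, 0] (by decide)
  have e : (fun i : Fin 3 => v i ((![Equiv.refl _, σ, τ] : Fin 3 → Equiv.Perm (Fin n)) i j)) =
      ![v 2 (τ j), v 0 j, v 1 (σ j)] ∘ ![1, 2, 0] := by
    funext i
    fin_cases i <;> rfl
  rw [e]
  exact this
end

section
/- For every odd integer n ≥ 3, the number of even Latin squares of order n equals the number of odd Latin squares of order n: ELS(n) = OLS(n). -/
/-- For odd `n ≥ 3` the number of even Latin squares of order `n` equals the
number of odd Latin squares of order `n`, i.e. `ELS(n) = OLS(n)`.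
A Latin square is encoded as a pair `p = (r, c)` where `r i` is the
permutation given by the `i`-th row and `c j` the permutation given by the
`j`-th column; the compatibility condition `c j i = r i j` says that `r` and
`c` come from one and the same square array whose rows and columns are all
permutations.  The sign of the square is the product (in `ℤˣ`) of the signs of
its `n` row permutations and `n` column permutations; the square is even if
this sign is `1` and odd if it is `-1`. -/
theorem even_latin_squares_eq_odd_latin_squares_of_odd
    (n : ℕ) (hn : 3 ≤ n) (hodd : Odd n) :
    (Finset.univ.filter
      (fun p : (Fin n → Equiv.Perm (Fin n)) × (Fin n → Equiv.Perm (Fin n)) =>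
        (∀ i j, p.2 j i = p.1 i j) ∧
        (∏ i, Equiv.Perm.sign (p.1 i)) * ∏ j, Equiv.Perm.sign (p.2 j) = 1)).card =
    (Finset.univ.filter
      (fun p : (Fin n → Equiv.Perm (Fin n)) × (Fin n → Equiv.Perm (Fin n)) =>
        (∀ i j, p.2 j i = p.1 i j) ∧
        (∏ i, Equiv.Perm.sign (p.1 i)) * ∏ j, Equiv.Perm.sign (p.2 j) = -1)).card := by
  obtain ⟨τ, hτ, hs⟩ : ∃ τ : Equiv.Perm (Fin n), τ * τ = 1 ∧ Equiv.Perm.sign τ = -1 := by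
    refine ⟨Equiv.swap ⟨0, by omega⟩ ⟨1, by omega⟩, Equiv.swap_mul_self _ _, ?_⟩
    apply Equiv.Perm.sign_swap
    simp
  have hτ2 : ∀ i, τ (τ i) = i := fun i => by
    rw [← Equiv.Perm.mul_apply, hτ, Equiv.Perm.one_apply]
  have key : ∀ p : (Fin n → Equiv.Perm (Fin n)) × (Fin n → Equiv.Perm (Fin n)),
      (∏ i, Equiv.Perm.sign (p.1 (τ i))) * ∏ j, Equiv.Perm.sign (p.2 j * τ) =
      - ((∏ i, Equiv.Perm.sign (p.1 i)) * ∏ j, Equiv.Perm.sign (p.2 j)) := by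
    intro p
    rw [Equiv.prod_comp τ (fun i => Equiv.Perm.sign (p.1 i))]
    simp only [Equiv.Perm.sign_mul, hs, Finset.prod_mul_distrib, Finset.prod_const,
      Finset.card_univ, Fintype.card_fin, hodd.neg_one_pow]
    rw [mul_neg, mul_one, mul_neg]
  refine Finset.card_bij' (fun p _ => (fun i => p.1 (τ i), fun j => p.2 j * τ))
    (fun p _ => (fun i => p.1 (τ i), fun j => p.2 j * τ)) ?_ ?_ ?_ ?_
  · intro p hp
    rw [Finset.mem_filter] at hp ⊢
    refine ⟨Finset.mem_univ _, fun i j => hp.2.1 (τ i) j, ?_⟩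
    rw [key p, hp.2.2]
  · intro p hp
    rw [Finset.mem_filter] at hp ⊢
    refine ⟨Finset.mem_univ _, fun i j => hp.2.1 (τ i) j, ?_⟩
    rw [key p, hp.2.2, neg_neg]
  · intro p hp
    simp [hτ2, mul_assoc, hτ]
  · intro p hp
    simp [hτ2, mul_assoc, hτ]
end

section
/- Let K be a field, n a positive integer, and let V_1,…,V_n be linear subspaces of K^n such that for every nonempty subset S ⊆ {1,…,n} the intersection ⋂_{j∈S} V_j has dimension at most n − |S|. Then for every basis v_1,…,v_n of K^n there exists a permutation π of {1,…,n} such that v_{π(j)} ∉ V_j for all j = 1,…,n. -/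
/-- Hall-type matching condition for subspaces: if `V_1, …, V_n` are subspaces
of `K^n` such that every nonempty subcollection of `ℓ` of them intersects in a
subspace of dimension at most `n − ℓ`, then for every basis `v_1, …, v_n` of
`K^n` there is a permutation `π` with `v_{π(j)} ∉ V_j` for all `j`. -/
theorem exists_matching_of_intersection_dim_bound
    (K : Type*) [Field K] (n : ℕ) (hn : 0 < n)
    (V : Fin n → Submodule K (Fin n → K))
    (hV : ∀ S : Finset (Fin n), S.Nonempty →
      Module.finrank K ↥(⨅ j ∈ S, V j) ≤ n - S.card)
    (v : Fin n → (Fin n → K))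
    (hv : LinearIndependent K v ∧ Submodule.span K (Set.range v) = ⊤) :
    ∃ π : Equiv.Perm (Fin n), ∀ j, v (π j) ∉ V j := by
  classical
  have hall := (Finset.all_card_le_biUnion_card_iff_exists_injective
    (fun j : Fin n => Finset.univ.filter (fun i => v i ∉ V j))).1 (by
    intro S
    rcases S.eq_empty_or_nonempty with rfl | hS
    · simp
    have h1 := hV S hS
    set N := S.biUnion (fun j : Fin n => Finset.univ.filter (fun i => v i ∉ V j)) with hN
    have hmem : ∀ i : (Nᶜ : Finset (Fin n)), v i ∈ (⨅ j ∈ S, V j) := by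
      rintro ⟨i, hi⟩
      simp only [Submodule.mem_iInf]
      intro j hj
      by_contra hc
      refine (Finset.mem_compl.1 hi) ?_
      rw [hN, Finset.mem_biUnion]
      exact ⟨j, hj, by simpa using hc⟩
    have hli : LinearIndependent K (fun i : (Nᶜ : Finset (Fin n)) => v i) :=
      hv.1.comp _ Subtype.val_injective
    have hli2 : LinearIndependent K
        (fun i : (Nᶜ : Finset (Fin n)) => (⟨v i, hmem i⟩ : ↥(⨅ j ∈ S, V j))) :=
      LinearIndependent.of_comp (Submodule.subtype _) hli
    have h2 := hli2.fintype_card_le_finrank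
    rw [Fintype.card_coe, Finset.card_compl, Fintype.card_fin] at h2
    have h3 := S.card_le_univ
    have h4 := N.card_le_univ
    rw [Fintype.card_fin] at h3 h4
    omega)
  obtain ⟨f, hf, hft⟩ := hall
  refine ⟨Equiv.ofBijective f (Finite.injective_iff_bijective.1 hf), fun j => ?_⟩
  simpa using hft j
end

section
/- Let K be a field, n a positive integer, 1 ≤ ℓ ≤ n, and let V_1,…,V_n be proper linear subspaces of K^n such that the intersection U := V_1 ∩ ⋯ ∩ V_ℓ has dimension strictly greater than n − ℓ. Then there exists a basis v_1,…,v_n of K^n such that for every permutation π of {1,…,n} there is some index j with v_{π(j)} ∈ V_j; in other words, no bijective assignment of the basis vectors to the subspaces avoids all of them. -/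
/-- If `V_1, …, V_n` are proper subspaces of `K^n` and the intersection
`U = V_1 ∩ ⋯ ∩ V_ℓ` of the first `ℓ` of them has dimension strictly greater
than `n − ℓ`, then there is a basis `v_1, …, v_n` of `K^n` such that no
permutation `π` avoids all subspaces: for every `π` some `v_{π(j)}` lies
in `V_j`. -/
theorem exists_unmatchable_basis_of_large_intersection
    (K : Type*) [Field K] (n ℓ : ℕ) (hℓ1 : 1 ≤ ℓ) (hℓn : ℓ ≤ n)
    (V : Fin n → Submodule K (Fin n → K))
    (hproper : ∀ j, V j ≠ ⊤)
    (hU : n - ℓ < Module.finrank K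
      ↥(⨅ j ∈ Finset.univ.filter (fun j : Fin n => (j : ℕ) < ℓ), V j)) :
    ∃ v : Fin n → (Fin n → K),
      (LinearIndependent K v ∧ Submodule.span K (Set.range v) = ⊤) ∧
      ∀ π : Equiv.Perm (Fin n), ∃ j, v (π j) ∈ V j := by
  classical
  set U : Submodule K (Fin n → K) :=
    ⨅ j ∈ Finset.univ.filter (fun j : Fin n => (j : ℕ) < ℓ), V j with hUdef
  obtain ⟨W, hW⟩ := U.exists_isCompl
  let b0 := ((Module.finBasis K U).prod (Module.finBasis K W)).map
    (Submodule.prodEquivOfIsCompl U W hW)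
  have hdim : Module.finrank K U + Module.finrank K W = n := by
    rw [Submodule.finrank_add_eq_of_isCompl hW]; simp
  let e : Fin (Module.finrank K U) ⊕ Fin (Module.finrank K W) ≃ Fin n :=
    finSumFinEquiv.trans (finCongr hdim)
  let b := b0.reindex e
  refine ⟨b, ⟨b.linearIndependent, b.span_eq⟩, ?_⟩
  intro π
  by_contra hcon
  push Not at hcon
  have key : ∀ i : Fin ℓ, ∃ k : Fin (Module.finrank K W),
      e.symm (π (Fin.castLE hℓn i)) = Sum.inr k := by
    intro i
    rcases h : e.symm (π (Fin.castLE hℓn i)) with a | k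
    · exfalso
      apply hcon (Fin.castLE hℓn i)
      have hb : b (π (Fin.castLE hℓn i)) ∈ U := by
        simp [b, b0, h]
      have hle : U ≤ V (Fin.castLE hℓn i) :=
        iInf₂_le (Fin.castLE hℓn i) (by simp)
      exact hle hb
    · exact ⟨k, rfl⟩
  choose f hf using key
  have hinj : Function.Injective f := by
    intro i i' h
    have h2 := (hf i).trans ((congrArg Sum.inr h).trans (hf i').symm)
    exact Fin.castLE_injective hℓn (π.injective (e.symm.injective h2))
  have hc := Fintype.card_le_of_injective f hinj
  simp only [Fintype.card_fin] at hc
  omega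
end

section
/- Let n > 2 be an odd integer and let K be a field containing a primitive m-th root of unity for every odd m ≤ n. Let (w_{ij}) be an (n−2) × n array of vectors in K^n such that each row (w_{i1},…,w_{in}) is a permutation of the standard basis e_1,…,e_n of K^n and in each column the n−2 vectors are pairwise distinct; for j = 1,…,n let V_j ⊆ K^n denote the span of the j-th column. Then there exists a basis v_1,…,v_n of K^n such that for every permutation π of {1,…,n}, either v_{π(j)} ∈ V_j for some j, or the intersection ⋂_{j=1}^n (V_j + span(v_{π(j)})) is a nonzero subspace of K^n. -/
open Finset in
lemma aux_match {n : ℕ} (M : Fin n → Finset (Fin n)) (h1 : ∀ j, (M j).card = 2)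
    (h2 : ∀ k, (univ.filter (fun j => k ∈ M j)).card = 2) :
    ∃ a b : Equiv.Perm (Fin n), (∀ j, a j ≠ b j) ∧ ∀ j, M j = {a j, b j} := by
  classical
  have hall : ∃ f : Fin n → Fin n, Function.Injective f ∧ ∀ x, f x ∈ M x := by
    rw [← Finset.all_card_le_biUnion_card_iff_exists_injective]
    intro s
    have e1 : ∑ j ∈ s, (M j).card = ∑ j ∈ s, ∑ k ∈ s.biUnion M, if k ∈ M j then 1 else 0 := by
      refine Finset.sum_congr rfl fun j hj => ?_
      rw [← Finset.sum_filter, ← Finset.card_eq_sum_ones]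
      congr 1
      ext k
      simp only [mem_filter, mem_biUnion]
      exact ⟨fun h => ⟨⟨j, hj, h⟩, h⟩, fun h => h.2⟩
    have e2 : ∑ k ∈ s.biUnion M, ∑ j ∈ s, (if k ∈ M j then 1 else 0) ≤ ∑ k ∈ s.biUnion M, 2 := by
      refine Finset.sum_le_sum fun k _ => ?_
      rw [← Finset.sum_filter, ← Finset.card_eq_sum_ones, ← h2 k]
      exact Finset.card_le_card (Finset.filter_subset_filter _ (Finset.subset_univ _))
    rw [Finset.sum_comm, Finset.sum_congr rfl (fun j _ => h1 j)] at e1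
    simp only [Finset.sum_const, smul_eq_mul] at e1 e2
    omega
  obtain ⟨a, ha, haM⟩ := hall
  have hb : ∀ j, ∃ b, (M j).erase (a j) = {b} := fun j => by
    rw [← Finset.card_eq_one, Finset.card_erase_of_mem (haM j), h1]
  choose b hb using hb
  have hM : ∀ j, M j = {a j, b j} := fun j => by
    rw [← hb j, Finset.insert_erase (haM j)]
  have hab : ∀ j, a j ≠ b j := fun j h => by
    have := h1 j
    rw [hM j, h] at this
    simp at this
  have hasurj := Finite.surjective_of_injective ha
  have hbinj : Function.Injective b := by
    intro j j' h
    by_contra hne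
    obtain ⟨j0, hj0⟩ := hasurj (b j)
    have n1 : j0 ≠ j := fun h' => hab j (h' ▸ hj0)
    have n2 : j0 ≠ j' := fun h' => hab j' (by rw [← h, ← hj0, h'])
    have hs : ({j0, j, j'} : Finset (Fin n)) ⊆ univ.filter (fun i => b j ∈ M i) := by
      intro i hi
      simp only [mem_insert, mem_singleton] at hi
      simp only [mem_filter, mem_univ, true_and, hM, mem_insert, mem_singleton]
      rcases hi with rfl | rfl | rfl
      · exact Or.inl hj0.symm
      · exact Or.inr rfl
      · exact Or.inr h
    have := Finset.card_le_card hs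
    rw [h2, Finset.card_eq_three.2 ⟨j0, j, j', n1, n2, hne, rfl⟩] at this
    omega
  exact ⟨Equiv.ofBijective a ⟨ha, hasurj⟩,
    Equiv.ofBijective b ⟨hbinj, Finite.surjective_of_injective hbinj⟩, hab, hM⟩

open Finset in
lemma aux_cols (n : ℕ) (hn : 2 < n) (K : Type*) [Field K]
    (w : Fin (n - 2) → Fin n → (Fin n → K))
    (hrows : ∀ i, ∃ σ : Equiv.Perm (Fin n),
      ∀ j, w i j = (Pi.single (σ j) 1 : Fin n → K))
    (hcols : ∀ j, Function.Injective (fun i => w i j)) :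
    ∃ a b : Equiv.Perm (Fin n), (∀ j, a j ≠ b j) ∧ ∀ j (x : Fin n → K), x (a j) = 0 →
      x (b j) = 0 → x ∈ Submodule.span K (Set.range fun i => w i j) := by
  classical
  choose σ hσ using hrows
  have hinj : ∀ j, Function.Injective (fun i => σ i j) := fun j i i' h => by
    apply hcols j
    simp only at h
    simp only [hσ, h]
  obtain ⟨a, b, hab, hM⟩ := aux_match (fun j => (univ.image (fun i => σ i j))ᶜ)
    (fun j => by
      rw [card_compl, card_image_of_injective _ (hinj j)]
      simp; omega)
    (fun k => by
      have : (univ.filter (fun j => k ∈ (univ.image (fun i => σ i j))ᶜ))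
          = (univ.image (fun i => (σ i).symm k))ᶜ := by
        ext j
        simp only [mem_filter, mem_univ, true_and, mem_compl, mem_image, Equiv.symm_apply_eq,
          eq_comm (a := k)]
      rw [this, card_compl, card_image_of_injective]
      · simp; omega
      · intro i i' h
        apply hinj ((σ i).symm k)
        simp only at h ⊢
        rw [Equiv.apply_symm_apply, h, Equiv.apply_symm_apply])
  refine ⟨a, b, hab, fun j x hxa hxb => ?_⟩
  have hx : x = ∑ k, x k • (Pi.single k 1 : Fin n → K) := by
    ext k
    simp [Finset.sum_apply, Pi.single_apply]
  rw [hx]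
  refine Submodule.sum_mem _ fun k _ => ?_
  by_cases h : k ∈ (univ.image (fun i => σ i j))ᶜ
  · rw [hM j] at h
    simp only [mem_insert, mem_singleton] at h
    rcases h with rfl | rfl <;> simp [hxa, hxb]
  · simp only [mem_compl, mem_image, mem_univ, true_and, not_not] at h
    obtain ⟨i, rfl⟩ := h
    refine Submodule.smul_mem _ _ (Submodule.subset_span ⟨i, hσ i j⟩)

open Finset in
/-- the odd cycle with its coordinates -/
lemma aux_cycle {n : ℕ} (hodd : Odd n) (a b : Equiv.Perm (Fin n)) (hab : ∀ j, a j ≠ b j) :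
    ∃ (m : ℕ) (C : Finset (Fin n)) (d : Fin n → ℕ) (q : ℕ → Fin n), Odd m ∧ m ≤ n ∧
      (∀ j, a j ∈ C ↔ b j ∈ C) ∧ (∀ t, t < m → q t ∈ C ∧ d (q t) = t) ∧
      (∀ k ∈ C, d k < m ∧ q (d k) = k) ∧
      (∀ j, a j ∈ C → d (b j) = if d (a j) + 1 = m then 0 else d (a j) + 1) := by
  classical
  set σ : Equiv.Perm (Fin n) := b * a⁻¹ with hσ
  have hσa : ∀ j, σ (a j) = b j := fun j => by simp [hσ]
  have hsupp : σ.support = univ := by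
    ext k
    obtain ⟨j, rfl⟩ := a.surjective k
    simp [hσa, (hab j).symm]
  have hsum := Equiv.Perm.sum_cycleType σ
  rw [hsupp, card_univ, Fintype.card_fin] at hsum
  have hex : ∃ c ∈ σ.cycleFactorsFinset, Odd c.support.card := by
    by_contra hcon
    push Not at hcon
    rw [Equiv.Perm.cycleType_def] at hsum
    have : Even n := by
      rw [← hsum]
      change Even (∑ c ∈ σ.cycleFactorsFinset, c.support.card)
      exact Finset.even_sum _ fun c hc => Nat.not_odd_iff_even.1 (hcon c hc)
    exact (Nat.not_odd_iff_even.2 this) hodd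
  obtain ⟨c, hc, hm⟩ := hex
  obtain ⟨hcyc, hcσ⟩ := Equiv.Perm.mem_cycleFactorsFinset_iff.1 hc
  obtain ⟨p, hp⟩ := hcyc.nonempty_support
  have hon : c.IsCycleOn (c.support : Set (Fin n)) := by
    have := hcyc.isCycleOn
    convert this using 1
    ext; simp
  have hex : ∀ k, ∃ t, k ∈ c.support → t < c.support.card ∧ (c ^ t) p = k := fun k => by
    by_cases hk : k ∈ c.support
    · obtain ⟨t, ht⟩ := hon.exists_pow_eq hp hk
      exact ⟨t, fun _ => ht⟩
    · exact ⟨0, fun h => absurd h hk⟩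
  choose d hd using hex
  have hmem : ∀ j, a j ∈ c.support ↔ b j ∈ c.support := fun j => by
    rw [← hσa]
    constructor
    · intro h
      rw [← hcσ _ h]
      exact Equiv.Perm.apply_mem_support.2 h
    · intro h
      have hz : (c : Equiv.Perm (Fin n)) ∈ σ.cycleFactorsFinset := hc
      have e := Equiv.Perm.mem_cycleFactorsFinset_support_le hc
      obtain ⟨y, hy⟩ := c.surjective (σ (a j))
      have hy' : y ∈ c.support := by
        rw [← Equiv.Perm.apply_mem_support, hy]; exact h
      rw [hcσ y hy'] at hy
      rw [← σ.injective hy]; exact hy'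
  have hqC : ∀ t, (c ^ t) p ∈ c.support := fun t => Equiv.Perm.pow_apply_mem_support.2 hp
  have huniq : ∀ s t, s < c.support.card → t < c.support.card → (c ^ s) p = (c ^ t) p → s = t := by
    intro s t hs ht h
    have := (hon.pow_apply_eq_pow_apply hp).1 h
    exact Nat.ModEq.eq_of_lt_of_lt this hs ht
  refine ⟨c.support.card, c.support, d, fun t => (c ^ t) p, hm, ?_, hmem, ?_, ?_, ?_⟩
  · simpa using Finset.card_le_univ c.support
  · intro t ht
    refine ⟨hqC t, ?_⟩
    have := hd _ (hqC t)
    exact huniq _ _ this.1 ht this.2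
  · intro k hk
    exact hd k hk
  · intro j hj
    have h1 := hd _ hj
    have h2 := hd _ ((hmem j).1 hj)
    have h3 : (c ^ (d (a j) + 1)) p = b j := by
      rw [pow_succ', Equiv.Perm.mul_apply, h1.2, hcσ _ hj, hσa]
    split_ifs with h
    · refine huniq _ _ h2.1 (by omega) ?_
      rw [h2.2, ← h3, h, pow_zero]
      simpa using hon.pow_card_apply hp
    · refine huniq _ _ h2.1 (by omega) ?_
      rw [h2.2, h3]

/-- Core of the failure of the online basis conjecture in odd dimension.
Let `n > 2` be odd and let `K` contain a primitive `m`-th root of unity for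
every odd `m ≤ n`.  Given an `(n−2) × n` array `w` of vectors in `K^n` in
which every row is a permutation of the standard basis (each `w i j` is the
standard basis vector `e_{σ_i(j)}` for some permutation `σ_i`) and the `n − 2`
vectors in each column are pairwise distinct, let `V_j` be the span of the
`j`-th column.  Then there is a basis `v_1, …, v_n` of `K^n` such that for
every permutation `π`, either some `v_{π(j)}` lies in `V_j`, or the
intersection of the enlarged column spaces `V_j + ⟨v_{π(j)}⟩` is nonzero. -/
theorem online_rota_odd_core
    (n : ℕ) (hn : 2 < n) (hodd : Odd n) (K : Type*) [Field K]
    (hprim : ∀ m : ℕ, Odd m → m ≤ n → ∃ ζ : K, IsPrimitiveRoot ζ m)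
    (w : Fin (n - 2) → Fin n → (Fin n → K))
    (hrows : ∀ i, ∃ σ : Equiv.Perm (Fin n),
      ∀ j, w i j = (Pi.single (σ j) 1 : Fin n → K))
    (hcols : ∀ j, Function.Injective (fun i => w i j)) :
    ∃ v : Fin n → (Fin n → K),
      (LinearIndependent K v ∧ Submodule.span K (Set.range v) = ⊤) ∧
      ∀ π : Equiv.Perm (Fin n),
        (∃ j, v (π j) ∈ Submodule.span K (Set.range fun i => w i j)) ∨
        (⨅ j, (Submodule.span K (Set.range fun i => w i j) ⊔
          Submodule.span K {v (π j)})) ≠ ⊥ := by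
  classical
  obtain ⟨a, b, hab, hV⟩ := aux_cols n hn K w hrows hcols
  obtain ⟨m, C, d, q, hm, hmn, hmem, hq, hd, hstep⟩ := aux_cycle hodd a b hab
  obtain ⟨ζ, hζ⟩ := hprim m hm hmn
  have hmpos : 0 < m := hm.pos
  have hζ0 : ζ ≠ 0 := hζ.ne_zero hmpos.ne'
  have hsum : ∀ {A : Type _} [AddCommMonoid A] (f : Fin n → A),
      ∑ k ∈ C, f k = ∑ t ∈ Finset.range m, f (q t) := by
    intro A _ f
    refine Finset.sum_bij' (fun k _ => d k) (fun t _ => q t) ?_ ?_ ?_ ?_ ?_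
    · intro k hk; exact Finset.mem_range.2 (hd k hk).1
    · intro t ht; exact (hq t (Finset.mem_range.1 ht)).1
    · intro k hk; exact (hd k hk).2
    · intro t ht; exact (hq t (Finset.mem_range.1 ht)).2
    · intro k hk; simp only [(hd k hk).2]
  have hsumN : ∀ (f : Fin n → ℕ), ∑ k ∈ C, f k = ∑ t ∈ Finset.range m, f (q t) := by
    intro f
    refine Finset.sum_bij' (fun k _ => d k) (fun t _ => q t) ?_ ?_ ?_ ?_ ?_
    · intro k hk; exact Finset.mem_range.2 (hd k hk).1
    · intro t ht; exact (hq t (Finset.mem_range.1 ht)).1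
    · intro k hk; exact (hd k hk).2
    · intro t ht; exact (hq t (Finset.mem_range.1 ht)).2
    · intro k hk; simp only [(hd k hk).2]
  set v : Fin n → Fin n → K := fun i k =>
    if i ∈ C then (if k ∈ C then ζ ^ (d i * d k) else 0) else (if k = i then 1 else 0) with hv
  have hvC : ∀ i k, i ∈ C → k ∈ C → v i k = ζ ^ (d i * d k) := fun i k hi hk => by
    simp [hv, hi, hk]
  have hli : LinearIndependent K v := by
    rw [Fintype.linearIndependent_iff]
    intro g hg
    have hout : ∀ k, k ∉ C → g k = 0 := by
      intro k hk
      have h := congrFun hg k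
      simp only [Finset.sum_apply, Pi.smul_apply, smul_eq_mul, Pi.zero_apply] at h
      rw [Finset.sum_eq_single k] at h
      · simpa [hv, hk] using h
      · intro i _ hi
        by_cases hiC : i ∈ C <;> simp [hv, hiC, hk, hi.symm]
      · simp
    have hin : ∀ t < m, ∑ s ∈ Finset.range m, g (q s) * (ζ ^ s) ^ t = 0 := by
      intro t ht
      have h := congrFun hg (q t)
      simp only [Finset.sum_apply, Pi.smul_apply, smul_eq_mul, Pi.zero_apply] at h
      rw [← Finset.sum_subset (Finset.subset_univ C)
        (fun i _ hi => by rw [hout i hi, zero_mul]), hsum] at h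
      rw [← h]
      refine Finset.sum_congr rfl fun s hs => ?_
      have hs' := hq s (Finset.mem_range.1 hs)
      rw [hvC _ _ hs'.1 (hq t ht).1, hs'.2, (hq t ht).2, pow_mul]
    have hz : (fun s : Fin m => g (q s)) = 0 := by
      apply Matrix.eq_zero_of_forall_pow_sum_mul_pow_eq_zero (f := fun s : Fin m => ζ ^ (s : ℕ))
      · intro s s' h
        exact Fin.ext (hζ.pow_inj s.2 s'.2 h)
      · intro t
        have := hin t t.2
        rw [Finset.sum_range] at this
        exact this
    intro i
    by_cases hi : i ∈ C
    · have := congrFun hz ⟨d i, (hd i hi).1⟩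
      simpa [(hd i hi).2] using this
    · exact hout i hi
  refine ⟨v, ⟨hli, hli.span_eq_top_of_card_eq_finrank' (by simp)⟩, ?_⟩
  intro π
  by_cases hcase : ∃ j, a j ∈ C ∧ π j ∉ C
  · obtain ⟨j, hj, hπ⟩ := hcase
    left
    refine ⟨j, hV j _ ?_ ?_⟩
    · have : a j ≠ π j := fun h => hπ (h ▸ hj)
      simp [hv, hπ, this]
    · have : b j ≠ π j := fun h => hπ (h ▸ (hmem j).1 hj)
      simp [hv, hπ, this]
  right
  push Not at hcase
  set r : Fin n → ℕ := fun k => d (π (a.symm k)) with hr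
  set X : ℕ → K := fun t => ζ ^ (∑ s ∈ Finset.range t, r (q s)) with hX
  have hXm : X m = 1 := by
    have hinj : Function.Injective (fun k => π (a.symm k)) := π.injective.comp a.symm.injective
    have himg : C.image (fun k => π (a.symm k)) = C := by
      apply Finset.eq_of_subset_of_card_le
      · intro y hy
        obtain ⟨k, hk, rfl⟩ := Finset.mem_image.1 hy
        exact hcase _ (by simpa using hk)
      · rw [Finset.card_image_of_injective _ hinj]
    have e1 : ∑ s ∈ Finset.range m, r (q s) = ∑ k ∈ C, d k := by
      rw [← hsumN]
      conv_rhs => rw [← himg]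
      rw [Finset.sum_image fun x _ y _ h => hinj h]
    have e2 : ∑ k ∈ C, d k = ∑ t ∈ Finset.range m, t := by
      rw [hsumN]
      exact Finset.sum_congr rfl fun t ht => (hq t (Finset.mem_range.1 ht)).2
    simp only [hX]
    rw [e1, e2, hζ.pow_eq_one_iff_dvd]
    obtain ⟨l, hl⟩ := hm
    have e3 := Finset.sum_range_id_mul_two m
    refine ⟨l, ?_⟩
    have : m - 1 = 2 * l := by omega
    rw [this] at e3
    nlinarith
  have hX0 : X 0 = 1 := by simp [hX]
  have hXs : ∀ t, X (t + 1) = X t * ζ ^ r (q t) := fun t => by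
    simp only [hX]
    rw [Finset.sum_range_succ, pow_add]
  set x : Fin n → K := fun k => if k ∈ C then X (d k) else 0 with hx
  have hxC : ∀ k ∈ C, x k = X (d k) := fun k hk => by simp [hx, hk]
  have hxne : x ≠ 0 := by
    intro h
    have h1 := congrFun h (q 0)
    rw [hxC _ (hq 0 hmpos).1, (hq 0 hmpos).2, hX0] at h1
    simp at h1
  have hxmem : x ∈ ⨅ j, (Submodule.span K (Set.range fun i => w i j) ⊔
          Submodule.span K {v (π j)}) := by
    rw [Submodule.mem_iInf]
    intro j
    by_cases hj : a j ∈ C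
    · have hbj := (hmem j).1 hj
      have hπ := hcase j hj
      set γ : K := X (d (a j)) * (ζ ^ (d (π j) * d (a j)))⁻¹ with hγ
      have hγ1 : γ * ζ ^ (d (π j) * d (a j)) = X (d (a j)) := by
        rw [hγ, mul_assoc, inv_mul_cancel₀ (pow_ne_zero _ hζ0), mul_one]
      have hra : r (q (d (a j))) = d (π j) := by
        rw [(hd _ hj).2]; simp [hr]
      have hXb : X (d (b j)) = X (d (a j)) * ζ ^ d (π j) := by
        rw [← hra, ← hXs, hstep j hj]
        split_ifs with h
        · rw [h, hXm, hX0]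
        · rfl
      have hpb : ζ ^ (d (π j) * d (b j)) = ζ ^ (d (π j) * d (a j)) * ζ ^ d (π j) := by
        rw [← pow_add, ← Nat.mul_succ, Nat.succ_eq_add_one, hstep j hj]
        split_ifs with h
        · rw [h, mul_comm _ m, pow_mul ζ m, hζ.pow_eq_one]; simp
        · rfl
      have h1 : x - γ • v (π j) ∈ Submodule.span K (Set.range fun i => w i j) := by
        apply hV j
        · rw [Pi.sub_apply, Pi.smul_apply, smul_eq_mul, hvC _ _ hπ hj, hγ1, hxC _ hj, sub_self]
        · rw [Pi.sub_apply, Pi.smul_apply, smul_eq_mul, hvC _ _ hπ hbj, hpb, ← mul_assoc, hγ1,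
            hxC _ hbj, hXb, sub_self]
      rw [← sub_add_cancel x (γ • v (π j))]
      exact Submodule.add_mem_sup h1
        (Submodule.smul_mem _ _ (Submodule.mem_span_singleton_self _))
    · have hbj : b j ∉ C := fun h => hj ((hmem j).2 h)
      exact Submodule.mem_sup_left (hV j x (by simp [hx, hj]) (by simp [hx, hbj]))
  intro hbot
  rw [hbot, Submodule.mem_bot] at hxmem
  exact hxne hxmem
end

section
/- Let K be a field that does not contain a primitive cube root of unity (i.e. there is no element of multiplicative order 3 in K; for example K = ℝ). Then OBC_3(K) holds: there exist functions s_1, s_2, s_3, where s_i maps an i × 3 array of vectors of K^3 to a permutation of {1,2,3}, such that for every 3 × 3 array (v_{ij}) of vectors in K^3 whose rows are bases of K^3, setting π_i := s_i(v_{1•},…,v_{i•}), every column j of the rearranged array, namely v_{1,π_1(j)}, v_{2,π_2(j)}, v_{3,π_3(j)}, is a basis of K^3. -/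
open Matrix in
theorem obc_key {K : Type*} [Field K] (A M : Matrix (Fin 3) (Fin 3) K) :
    (Matrix.of fun j => crossProduct (A j) (M j ᵥ* A)).det
      = A.det ^ 2 * (M 0 1 * M 1 2 * M 2 0 - M 0 2 * M 1 0 * M 2 1) := by
  simp only [Matrix.det_fin_three, Matrix.of_apply, cross_apply, Matrix.vecMul, dotProduct,
    Fin.sum_univ_three, Matrix.cons_val_zero, Matrix.cons_val_one, Matrix.cons_val]
  ring

open Matrix in
theorem obc_two {K : Type*} [Field K] (hcube : ∀ ζ : K, ¬ IsPrimitiveRoot ζ 3)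
    (A B : Matrix (Fin 3) (Fin 3) K) (hA : A.det ≠ 0) (hB : B.det ≠ 0) :
    ∃ π : Equiv.Perm (Fin 3),
      (Matrix.of fun j => crossProduct (A j) (B (π j))).det ≠ 0 := by
  by_contra hcon
  push Not at hcon
  obtain ⟨M, rfl⟩ : ∃ M, B = M * A :=
    ⟨B * A⁻¹, by rw [Matrix.mul_assoc, Matrix.nonsing_inv_mul _ (isUnit_iff_ne_zero.2 hA), mul_one]⟩
  have hM : M.det ≠ 0 := by
    rw [Matrix.det_mul] at hB
    exact left_ne_zero_of_mul hB
  have h : ∀ π : Equiv.Perm (Fin 3), M (π 0) 1 * M (π 1) 2 * M (π 2) 0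
      - M (π 0) 2 * M (π 1) 0 * M (π 2) 1 = 0 := by
    intro π
    have h1 := obc_key A (fun j => M (π j))
    have h2 := hcon π
    have h3 : (Matrix.of fun j => crossProduct (A j) ((M * A) (π j)))
        = (Matrix.of fun j => crossProduct (A j) (M (π j) ᵥ* A)) := by
      ext j k
      rfl
    rw [h3, h1] at h2
    exact (mul_eq_zero.1 h2).resolve_left (pow_ne_zero 2 hA)
  have e1 := h 1
  have e2 := h (finRotate 3)
  have o1 := h (Equiv.swap 0 1)
  have o2 := h (Equiv.swap 0 2)
  have r0 : finRotate 3 0 = 1 := by decide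
  have r1 : finRotate 3 1 = 2 := by decide
  have r2 : finRotate 3 2 = 0 := by decide
  have s0 : Equiv.swap (0 : Fin 3) 1 2 = 2 := by decide
  have s1 : Equiv.swap (0 : Fin 3) 2 1 = 1 := by decide
  simp only [Equiv.Perm.one_apply, r0, r1, r2, s0, s1, Equiv.swap_apply_left,
    Equiv.swap_apply_right] at e1 e2 o1 o2
  rw [Matrix.det_fin_three] at hM
  obtain ⟨p, hp⟩ : ∃ p, p = M 0 0 * M 1 1 * M 2 2 := ⟨_, rfl⟩
  obtain ⟨q, hq⟩ : ∃ q, q = M 0 0 * M 1 2 * M 2 1 := ⟨_, rfl⟩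
  have p2 : M 0 1 * M 1 2 * M 2 0 = p := by grind
  have p3 : M 0 2 * M 1 0 * M 2 1 = p := by grind
  have q2 : M 0 1 * M 1 0 * M 2 2 = q := by grind
  have q3 : M 0 2 * M 1 1 * M 2 0 = q := by grind
  have hpq : p ≠ q := by
    intro hh
    apply hM
    linear_combination -hp + hq + p2 - q2 + p3 - q3 + 3 * hh
  have hc : p ^ 3 = q ^ 3 := by
    have t1 : p ^ 3 = (M 0 0 * M 1 1 * M 2 2) * (M 0 1 * M 1 2 * M 2 0)
      * (M 0 2 * M 1 0 * M 2 1) := by rw [p2, p3, ← hp]; ring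
    have t2 : q ^ 3 = (M 0 0 * M 1 2 * M 2 1) * (M 0 1 * M 1 0 * M 2 2)
      * (M 0 2 * M 1 1 * M 2 0) := by rw [q2, q3, ← hq]; ring
    rw [t1, t2]; ring
  have hq0 : q ≠ 0 := by
    rintro h0
    rw [h0] at hc hpq
    exact hpq (pow_eq_zero_iff (n := 3) (by norm_num) |>.1 (by simpa using hc))
  apply hcube (p / q)
  have ho : orderOf (p / q) = 3 := by
    haveI : Fact (Nat.Prime 3) := ⟨Nat.prime_three⟩
    apply orderOf_eq_prime
    · rw [div_pow, hc, div_self (pow_ne_zero 3 hq0)]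
    · intro h1
      exact hpq ((div_eq_one_iff_eq hq0).1 h1)
  exact ho ▸ IsPrimitiveRoot.orderOf (p / q)

open Matrix in
theorem obc_three {K : Type*} [Field K] (A B C : Matrix (Fin 3) (Fin 3) K)
    (hN : (Matrix.of fun j => crossProduct (A j) (B j)).det ≠ 0) (hC : C.det ≠ 0) :
    ∃ τ : Equiv.Perm (Fin 3), ∀ j,
      (Matrix.of ![A j, B j, C (τ j)]).det ≠ 0 := by
  set N := (Matrix.of fun j => crossProduct (A j) (B j)) with hNd
  have h : (C * Nᵀ).det ≠ 0 := by
    rw [Matrix.det_mul, Matrix.det_transpose]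
    exact mul_ne_zero hC hN
  rw [Matrix.det_apply] at h
  obtain ⟨τ, -, hτ⟩ := Finset.exists_ne_zero_of_sum_ne_zero h
  refine ⟨τ, fun j => ?_⟩
  have h2 : ∏ i, (C * Nᵀ) (τ i) i ≠ 0 := by
    intro h0
    rw [h0] at hτ
    simp at hτ
  have h3 := (Finset.prod_ne_zero_iff.1 h2) j (Finset.mem_univ j)
  intro h4
  apply h3
  rw [← h4]
  simp [hNd, Matrix.mul_apply, Matrix.det_fin_three, Fin.sum_univ_three, cross_apply]
  ring

theorem obc_det {K : Type*} [Field K] (v : Fin 3 → Fin 3 → K) :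
    LinearIndependent K v ↔ (Matrix.of v).det ≠ 0 := by
  rw [← isUnit_iff_ne_zero, ← Matrix.isUnit_iff_isUnit_det,
    ← Matrix.linearIndependent_rows_iff_isUnit]
  rfl

/-- If the field `K` contains no primitive cube root of unity (e.g. `K = ℝ`),
then the online version `OBC_3(K)` of Rota's basis conjecture holds: there are
strategies `s i` (where `s i` sees only rows `0, …, i` of the array, in
`Fin`-indexing, and outputs the permutation to be applied to row `i`) such
that for every `3 × 3` array of vectors of `K^3` whose rows are bases, all
columns of the rearranged array are bases. -/
theorem online_rota_dim_three_of_no_primitive_cube_root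
    (K : Type*) [Field K]
    (hcube : ∀ ζ : K, ¬ IsPrimitiveRoot ζ 3) :
    ∃ s : (i : Fin 3) → (Fin ((i : ℕ) + 1) → Fin 3 → (Fin 3 → K)) → Equiv.Perm (Fin 3),
      ∀ v : Fin 3 → Fin 3 → (Fin 3 → K),
        (∀ i, LinearIndependent K (v i) ∧
          Submodule.span K (Set.range (v i)) = ⊤) →
        ∀ j, LinearIndependent K
            (fun i => v i (s i (fun k => v (Fin.castLE i.isLt k)) j)) ∧
          Submodule.span K
            (Set.range fun i => v i (s i (fun k => v (Fin.castLE i.isLt k)) j)) = ⊤ := by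
  classical
  have H2 : ∀ A B : Fin 3 → Fin 3 → K, ∃ π : Equiv.Perm (Fin 3),
      LinearIndependent K A → LinearIndependent K B →
      (Matrix.of fun j => crossProduct (A j) (B (π j))).det ≠ 0 := by
    intro A B
    by_cases h : LinearIndependent K A ∧ LinearIndependent K B
    · obtain ⟨π, hπ⟩ := obc_two hcube (Matrix.of A) (Matrix.of B)
        ((obc_det A).1 h.1) ((obc_det B).1 h.2)
      exact ⟨π, fun _ _ => hπ⟩
    · exact ⟨1, fun h1 h2 => absurd ⟨h1, h2⟩ h⟩
  choose p hp using H2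
  have H3 : ∀ A B C : Fin 3 → Fin 3 → K, ∃ τ : Equiv.Perm (Fin 3),
      LinearIndependent K A → LinearIndependent K B → LinearIndependent K C →
      ∀ j, LinearIndependent K ![A j, B (p A B j), C (τ j)] := by
    intro A B C
    by_cases h : LinearIndependent K A ∧ LinearIndependent K B ∧ LinearIndependent K C
    · obtain ⟨τ, hτ⟩ := obc_three (Matrix.of A) (Matrix.of fun j => B (p A B j)) (Matrix.of C)
        (hp A B h.1 h.2.1) ((obc_det C).1 h.2.2)
      exact ⟨τ, fun _ _ _ j => (obc_det _).2 (hτ j)⟩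
    · exact ⟨1, fun h1 h2 h3 => absurd ⟨h1, h2, h3⟩ h⟩
  choose q hq using H3
  refine ⟨fun i => match i with
    | 0 => fun _ => 1
    | 1 => fun w => p (w 0) (w 1)
    | 2 => fun w => q (w 0) (w 1) (w 2), ?_⟩
  intro v hv j
  have key := hq (v 0) (v 1) (v 2) (hv 0).1 (hv 1).1 (hv 2).1 j
  refine (fun hli => ⟨hli, hli.span_eq_top_of_card_eq_finrank (by simp)⟩) ?_
  convert key using 1
  funext i
  fin_cases i <;> rfl
end

section
/- Let n ≥ 3 be an integer and let E be the ground set {1,…,n−1} × {1,…,n} together with one extra element e. Then there exists a matroid M on E of rank n with the following properties: (1) the restriction of M to {1,…,n−1} × {1,…,n} is the uniform matroid of rank n on (n−1)n elements (every subset of {1,…,n−1} × {1,…,n} of cardinality at most n is independent); and (2) a subset of E of cardinality n is dependent in M if and only if it equals {(i,j) : i = 1,…,n−1} ∪ {e} for some j ∈ {1,…,n}, i.e. the only dependent n-element sets are the n 'columns' completed by e. -/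
/-- Sparse paving style construction on a finite type. -/
theorem exists_paving {α ι : Type*} [Finite α] (n : ℕ) (hn : 0 < n) (C : ι → Set α)
    (hC : ∀ j, (C j).ncard = n)
    (hCC : ∀ j k (X : Set α), X.ncard + 1 = n → X ⊆ C j → X ⊆ C k → j = k) :
    ∃ M : Matroid α, M.E = Set.univ ∧
      ∀ I, M.Indep I ↔ I.ncard ≤ n ∧ ∀ j, I ≠ C j := by
  refine ⟨(IndepMatroid.ofBddAugment Set.univ (fun I => I.ncard ≤ n ∧ ∀ j, I ≠ C j)
    ?_ ?_ ?_ ?_ ?_).matroid, rfl, fun I => Iff.rfl⟩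
  · refine ⟨by simp, fun j h => ?_⟩
    have := hC j
    rw [← h] at this
    simp at this
    omega
  · rintro I J ⟨hJ, hJC⟩ hIJ
    refine ⟨(Set.ncard_le_ncard hIJ (Set.toFinite _)).trans hJ, fun j h => ?_⟩
    subst h
    exact hJC j (Set.eq_of_subset_of_ncard_le hIJ (by rw [hC]; exact hJ) (Set.toFinite _)).symm
  · rintro I J ⟨hI, hIC⟩ ⟨hJ, hJC⟩ hlt
    have hlt' : I.ncard < J.ncard := by
      rw [← (Set.toFinite I).cast_ncard_eq, ← (Set.toFinite J).cast_ncard_eq] at hlt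
      exact_mod_cast hlt
    by_contra! hcon
    have hins : ∀ e ∈ J, e ∉ I → ∃ j, insert e I = C j := by
      intro e he heI
      by_contra! h2
      have h3 := Set.ncard_insert_of_notMem heI (Set.toFinite I)
      obtain ⟨j, hj⟩ := hcon e he heI (by omega)
      exact h2 j hj
    obtain ⟨e, he, heI⟩ := Set.exists_mem_notMem_of_ncard_lt_ncard hlt' (Set.toFinite I)
    obtain ⟨j, hj⟩ := hins e he heI
    have h3 := Set.ncard_insert_of_notMem heI (Set.toFinite I)
    rw [hj, hC] at h3
    have hIj : I ⊆ C j := hj ▸ Set.subset_insert e I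
    have hJj : J ⊆ C j := by
      intro f hf
      by_cases hfI : f ∈ I
      · exact hIj hfI
      · obtain ⟨k, hk⟩ := hins f hf hfI
        have hIk : I ⊆ C k := hk ▸ Set.subset_insert f I
        rw [hCC j k I h3.symm hIj hIk, ← hk]
        exact Set.mem_insert _ _
    exact hJC j (Set.eq_of_subset_of_ncard_le hJj (by rw [hC]; omega) (Set.toFinite _))
  · refine ⟨n, fun I hI => ?_⟩
    rw [← (Set.toFinite I).cast_ncard_eq]
    exact_mod_cast hI.1
  · exact fun I _ => Set.subset_univ I

/-- For every `n ≥ 3` there is a matroid of rank `n` on the ground set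
`E = ({1,…,n−1} × {1,…,n}) ⊕ {e}` (with `e` the extra element `Sum.inr ()`)
such that:
(1) its restriction to the grid `{1,…,n−1} × {1,…,n}` is the uniform matroid
of rank `n` (a set of grid elements is independent iff it has at most `n`
elements), and
(2) an `n`-element subset of `E` is dependent iff it is one of the `n`
"columns completed by `e`", i.e. `{(i, j) : i} ∪ {e}` for some `j`.
The clauses about cardinalities of independent sets express that the rank
of the matroid is `n`. -/
theorem exists_one_element_extension_of_uniform_matroid
    (n : ℕ) (hn : 3 ≤ n) :
    ∃ M : Matroid ((Fin (n - 1) × Fin n) ⊕ Unit),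
      M.E = Set.univ ∧
      (∀ I : Set ((Fin (n - 1) × Fin n) ⊕ Unit), M.Indep I → I.ncard ≤ n) ∧
      (∃ I : Set ((Fin (n - 1) × Fin n) ⊕ Unit), M.Indep I ∧ I.ncard = n) ∧
      (∀ S : Set ((Fin (n - 1) × Fin n) ⊕ Unit), Sum.inr () ∉ S →
        (M.Indep S ↔ S.ncard ≤ n)) ∧
      (∀ S : Set ((Fin (n - 1) × Fin n) ⊕ Unit), S.ncard = n →
        (¬ M.Indep S ↔ ∃ j : Fin n,
          S = {x | ∃ i : Fin (n - 1), x = Sum.inl (i, j)} ∪ {Sum.inr ()})) := by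
  let C : Fin n → Set ((Fin (n - 1) × Fin n) ⊕ Unit) := fun j =>
    {x | ∃ i : Fin (n - 1), x = Sum.inl (i, j)} ∪ {Sum.inr ()}
  have hC : ∀ j, (C j).ncard = n := by
    intro j
    have h1 : C j = insert (Sum.inr ())
        (Set.range (fun i : Fin (n - 1) => (Sum.inl (i, j) : (Fin (n - 1) × Fin n) ⊕ Unit))) := by
      ext x
      simp [C, eq_comm]
    rw [h1, Set.ncard_insert_of_notMem (by simp) (Set.toFinite _), ← Set.image_univ,
      Set.ncard_image_of_injective _ (fun a b h => by simpa using h), Set.ncard_univ]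
    simp
    omega
  have hCC : ∀ j k (X : Set ((Fin (n - 1) × Fin n) ⊕ Unit)), X.ncard + 1 = n →
      X ⊆ C j → X ⊆ C k → j = k := by
    intro j k X hX hj hk
    by_contra hne
    have hs : X ⊆ {Sum.inr ()} := by
      intro x hx
      rcases hj hx with ⟨i, rfl⟩ | h
      · rcases hk hx with ⟨i', h'⟩ | h'
        · simp at h'
          exact absurd h'.2 hne
        · simp at h'
      · exact h
    have := Set.ncard_le_ncard hs (Set.toFinite _)
    rw [Set.ncard_singleton] at this
    omega
  obtain ⟨M, hE, hM⟩ := exists_paving n (by omega) C hC hCC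
  have hgrid : ∀ S : Set ((Fin (n - 1) × Fin n) ⊕ Unit), Sum.inr () ∉ S →
      (M.Indep S ↔ S.ncard ≤ n) := by
    intro S hS
    rw [hM]
    refine ⟨fun h => h.1, fun h => ⟨h, ?_⟩⟩
    rintro j rfl
    exact hS (Or.inr rfl)
  refine ⟨M, hE, fun I hI => ((hM I).1 hI).1, ?_, hgrid, ?_⟩
  · have hcard : n ≤ (Set.range (Sum.inl : _ → (Fin (n - 1) × Fin n) ⊕ Unit)).ncard := by
      rw [← Set.image_univ, Set.ncard_image_of_injective _ Sum.inl_injective, Set.ncard_univ]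
      simp
      exact Nat.le_mul_of_pos_left n (by omega)
    obtain ⟨I, hI, hIn⟩ := Set.exists_subset_card_eq hcard
    refine ⟨I, (hgrid I fun h => ?_).2 hIn.le, hIn⟩
    simpa using hI h
  · intro S hS
    rw [hM]
    simp only [hS, le_refl, true_and, not_forall, not_not, ne_eq]
    rfl
end

section
/- Let K be an infinite field and n ≤ d positive integers, and suppose that Rota's basis conjecture RBC_n(K) holds (for every n × n array of vectors in K^n whose rows are bases of K^n, the vectors can be permuted within their rows so that all columns are bases). Then the following generalisation holds: for every n × n array (v_{ij}) of vectors in K^d such that for each i the row v_{i1},…,v_{in} consists of n linearly independent vectors, there exist permutations π_1,…,π_n of {1,…,n} such that for every j = 1,…,n the vectors v_{1,π_1(j)}, …, v_{n,π_n(j)} are linearly independent in K^d. -/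
theorem aux_generic (K : Type*) [Field K] [Infinite K] (n d : ℕ)
    (v : Fin n → Fin n → (Fin d → K))
    (hrows : ∀ i, LinearIndependent K (v i)) :
    ∃ N : Matrix (Fin d) (Fin n) K, ∀ i, (Matrix.of (v i) * N).det ≠ 0 := by
  classical
  let X : Matrix (Fin d) (Fin n) (MvPolynomial (Fin d × Fin n) K) :=
    Matrix.of fun a b => MvPolynomial.X (a, b)
  let V : Fin n → Matrix (Fin n) (Fin d) (MvPolynomial (Fin d × Fin n) K) := fun i =>
    Matrix.of fun a b => MvPolynomial.C (v i a b)
  let P : Fin n → Matrix (Fin n) (Fin n) (MvPolynomial (Fin d × Fin n) K) := fun i =>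
    V i * X
  let p : Fin n → MvPolynomial (Fin d × Fin n) K := fun i =>
    (P i).det
  have hev : ∀ (N : Matrix (Fin d) (Fin n) K) i,
      MvPolynomial.eval (fun q => N q.1 q.2) (p i) = (Matrix.of (v i) * N).det := by
    intro N i
    refine (RingHom.map_det _ _).trans ?_
    congr 1
    ext a b
    change MvPolynomial.eval (fun q : Fin d × Fin n => N q.1 q.2)
      ((V i * X) a b) = _
    rw [Matrix.mul_apply, Matrix.mul_apply, map_sum]
    refine Finset.sum_congr rfl fun j _ => ?_
    rw [map_mul]
    simp [V, X]
  have hp : ∀ i, p i ≠ 0 := by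
    intro i h0
    obtain ⟨g, hg⟩ := (Fintype.linearCombination K (v i)).exists_leftInverse_of_injective
      (LinearMap.ker_eq_bot.2 ((hrows i).fintypeLinearCombination_injective))
    have h1 : ∀ j, g (v i j) = Pi.single j 1 := by
      intro j
      have := LinearMap.congr_fun hg (Pi.single j 1)
      simpa [Fintype.linearCombination_apply_single] using this
    have h2 := hev (LinearMap.toMatrix' g).transpose i
    have h3 : Matrix.of (v i) * (LinearMap.toMatrix' g).transpose = 1 := by
      ext a b
      have h4 := congrFun (LinearMap.toMatrix'_mulVec g (v i a)) b
      rw [h1] at h4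
      rw [Matrix.mul_apply, Matrix.one_apply]
      simp only [Matrix.mulVec, dotProduct, Pi.single_apply] at h4
      simp only [Matrix.of_apply, Matrix.transpose_apply]
      rw [← show (if b = a then (1 : K) else 0) = if a = b then 1 else 0 by simp [eq_comm], ← h4]
      exact Finset.sum_congr rfl fun _ _ => mul_comm _ _
    rw [h3, h0] at h2
    simp at h2
  have hprod : ∏ i, p i ≠ 0 := Finset.prod_ne_zero_iff.2 fun i _ => hp i
  by_contra hcon
  push Not at hcon
  apply hprod
  apply MvPolynomial.funext
  intro x
  obtain ⟨i, hi⟩ := hcon (Matrix.of fun a b => x (a, b))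
  rw [map_prod, map_zero]
  refine Finset.prod_eq_zero (Finset.mem_univ i) ?_
  rw [← hi, ← hev]
  rfl


/-- Over an infinite field `K`, Rota's basis conjecture `RBC_n(K)` (stated as
the hypothesis `hRBC`) implies its generalisation to `n × n` arrays of vectors
in `K^d` with `d ≥ n`: if each row of the array consists of `n` linearly
independent vectors of `K^d`, then the vectors can be permuted within their
rows so that afterwards each column consists of `n` linearly independent
vectors. -/
theorem rota_generalisation_of_rota
    (K : Type*) [Field K] [Infinite K] (n d : ℕ) (hn : 0 < n) (hnd : n ≤ d)
    (hRBC : ∀ v : Fin n → Fin n → (Fin n → K),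
      (∀ i, LinearIndependent K (v i) ∧
        Submodule.span K (Set.range (v i)) = ⊤) →
      ∃ π : Fin n → Equiv.Perm (Fin n),
        ∀ j, LinearIndependent K (fun i => v i (π i j)) ∧
          Submodule.span K (Set.range fun i => v i (π i j)) = ⊤)
    (v : Fin n → Fin n → (Fin d → K))
    (hrows : ∀ i, LinearIndependent K (v i)) :
    ∃ π : Fin n → Equiv.Perm (Fin n),
      ∀ j, LinearIndependent K (fun i => v i (π i j)) := by

  obtain ⟨N, hN⟩ := aux_generic K n d v hrows
  have key : ∀ i, LinearIndependent K (fun j => Matrix.vecMulLinear N (v i j)) := by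
    intro i
    have := Matrix.linearIndependent_rows_of_det_ne_zero (hN i)
    exact this
  obtain ⟨π, hπ⟩ := hRBC (fun i j => Matrix.vecMulLinear N (v i j)) fun i =>
    ⟨key i, (key i).span_eq_top_of_card_eq_finrank' (by simp)⟩
  exact ⟨π, fun j => LinearIndependent.of_comp (Matrix.vecMulLinear N) (hπ j).1⟩
end
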